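/- arXiv:1206.5209 — 3 statements merged into one kernel-verified Lean document; each statement's English description precedes it below -/
import Mathlib

section
/- Carleman inequality with observation at x = −1 (Remark 4): There exist C > 0 and s0 > 0 such that for every T > 0, every a ≥ 0, every ε ∈ (0,1), every s ≥ s0 ( ε^{−1}(T + T²) + a^{1/2} ε^{−1/2} T² ), and every classical solution φ of (S'^a), the following holds: s³ ∫∫_Q w̃³ e^{−2sα̃} |φ|² dx dt + s³ ∫_0^T [ (w̃³ e^{−2sα̃} |φ|²)(t,0) + (w̃³ e^{−2sα̃} |φ|²)(t,−1) ] dt ≤ C s⁷ ∫_0^T e^{−4sα̃(t,−1) + 2sα̃(t,0)} w̃(t,−1)⁷ |φ(t,−1)|² dt. -/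
open Real MeasureTheory intervalIntegral Set

noncomputable section

/-- A classical solution of the one-dimensional adjoint system `(S'^a)`:
`φ ∈ C^∞`, satisfying `∂_t φ + ∂_x φ + ε ∂_x² φ − a φ = 0` on `Q = (0,T)×(−1,0)`,
the boundary condition `ε(∂_t φ(t,0) − ∂_x φ(t,0)) − φ(t,0) = 0` and
`∂_t φ(t,−1) + ∂_x φ(t,−1) = 0` for `t ∈ (0,T)`. -/
def IsAdjSol1D (T ε a : ℝ) (φ : ℝ → ℝ → ℝ) : Prop :=
  ContDiff ℝ (⊤ : ℕ∞) (fun p : ℝ × ℝ => φ p.1 p.2) ∧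
  (∀ t ∈ Set.Ioo (0:ℝ) T, ∀ x ∈ Set.Ioo (-1:ℝ) 0,
    deriv (fun s => φ s x) t + deriv (fun y => φ t y) x
      + ε * deriv (deriv (fun y => φ t y)) x - a * φ t x = 0) ∧
  (∀ t ∈ Set.Ioo (0:ℝ) T,
    ε * (deriv (fun s => φ s 0) t - deriv (fun y => φ t y) 0) - φ t 0 = 0) ∧
  (∀ t ∈ Set.Ioo (0:ℝ) T,
    deriv (fun s => φ s (-1)) t + deriv (fun y => φ t y) (-1) = 0)

/-- The squared `X¹`-norm: `‖ψ‖²_{X¹} = ∫_{−1}^0 |ψ|² + ε(|ψ(0)|² + |ψ(−1)|²)`. -/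
def X1normSq (ε : ℝ) (ψ : ℝ → ℝ) : ℝ :=
  (∫ x in (-1:ℝ)..0, ψ x ^ 2) + ε * (ψ 0 ^ 2 + ψ (-1) ^ 2)

/-- Carleman weight built from `η(x) = 1 − x`: `α̃(t,x) = (e³ − e^{1−x})/(t(T−t))`. -/
def carlA' (T t x : ℝ) : ℝ := (Real.exp 3 - Real.exp (1 - x)) / (t * (T - t))

/-- Carleman weight `w̃(t,x) = e^{1−x}/(t(T−t))`. -/
def carlW' (T t x : ℝ) : ℝ := Real.exp (1 - x) / (t * (T - t))

open scoped ContDiff Topology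

/-- The partial derivative in the first (time) variable. -/
def Dt (u : ℝ → ℝ → ℝ) (t x : ℝ) : ℝ := deriv (fun s => u s x) t

/-- The partial derivative in the second (space) variable. -/
def Dx (u : ℝ → ℝ → ℝ) (t x : ℝ) : ℝ := deriv (fun y => u t y) x

/-- Joint smoothness of a function of two real variables. -/
def Smooth2 (u : ℝ → ℝ → ℝ) : Prop := ContDiff ℝ ∞ (fun p : ℝ × ℝ => u p.1 p.2)

namespace Smooth2

variable {u : ℝ → ℝ → ℝ}

theorem hasDerivAt_line_t (hu : Smooth2 u) (t x : ℝ) :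
    HasDerivAt (fun s => u s x) (fderiv ℝ (fun p : ℝ × ℝ => u p.1 p.2) (t, x) (1, 0)) t := by
  have h := (hu.differentiable (by simp) (t, x)).hasFDerivAt
  exact HasFDerivAt.comp_hasDerivAt (f := fun s : ℝ => (s, x)) t h
    ((hasDerivAt_id t).prodMk (hasDerivAt_const t x))

theorem hasDerivAt_line_x (hu : Smooth2 u) (t x : ℝ) :
    HasDerivAt (fun y => u t y) (fderiv ℝ (fun p : ℝ × ℝ => u p.1 p.2) (t, x) (0, 1)) x := by
  have h := (hu.differentiable (by simp) (t, x)).hasFDerivAt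
  exact HasFDerivAt.comp_hasDerivAt (f := fun y : ℝ => (t, y)) x h
    ((hasDerivAt_const x t).prodMk (hasDerivAt_id x))

theorem Dt_eq (hu : Smooth2 u) (t x : ℝ) :
    Dt u t x = fderiv ℝ (fun p : ℝ × ℝ => u p.1 p.2) (t, x) (1, 0) :=
  (hu.hasDerivAt_line_t t x).deriv

theorem Dx_eq (hu : Smooth2 u) (t x : ℝ) :
    Dx u t x = fderiv ℝ (fun p : ℝ × ℝ => u p.1 p.2) (t, x) (0, 1) :=
  (hu.hasDerivAt_line_x t x).deriv

theorem hasDerivAt_t (hu : Smooth2 u) (t x : ℝ) : HasDerivAt (fun s => u s x) (Dt u t x) t := by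
  rw [hu.Dt_eq]; exact hu.hasDerivAt_line_t t x

theorem hasDerivAt_x (hu : Smooth2 u) (t x : ℝ) : HasDerivAt (fun y => u t y) (Dx u t x) x := by
  rw [hu.Dx_eq]; exact hu.hasDerivAt_line_x t x

theorem dt (hu : Smooth2 u) : Smooth2 (Dt u) := by
  have h : (fun p : ℝ × ℝ => Dt u p.1 p.2)
      = fun p => fderiv ℝ (fun p : ℝ × ℝ => u p.1 p.2) p (1, 0) := by
    funext p; exact hu.Dt_eq p.1 p.2
  unfold Smooth2
  rw [h]
  exact (ContDiff.fderiv_right hu (m := ∞) (by simp)).clm_apply contDiff_const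

theorem dx (hu : Smooth2 u) : Smooth2 (Dx u) := by
  have h : (fun p : ℝ × ℝ => Dx u p.1 p.2)
      = fun p => fderiv ℝ (fun p : ℝ × ℝ => u p.1 p.2) p (0, 1) := by
    funext p; exact hu.Dx_eq p.1 p.2
  unfold Smooth2
  rw [h]
  exact (ContDiff.fderiv_right hu (m := ∞) (by simp)).clm_apply contDiff_const

theorem Dx_Dt (hu : Smooth2 u) : Dx (Dt u) = Dt (Dx u) := by
  funext t x
  rw [hu.dt.Dx_eq, hu.dx.Dt_eq]
  have h1 : (fun p : ℝ × ℝ => Dt u p.1 p.2)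
      = fun p => fderiv ℝ (fun p : ℝ × ℝ => u p.1 p.2) p (1, 0) := by
    funext p; exact hu.Dt_eq p.1 p.2
  have h2 : (fun p : ℝ × ℝ => Dx u p.1 p.2)
      = fun p => fderiv ℝ (fun p : ℝ × ℝ => u p.1 p.2) p (0, 1) := by
    funext p; exact hu.Dx_eq p.1 p.2
  have hd : DifferentiableAt ℝ (fderiv ℝ (fun p : ℝ × ℝ => u p.1 p.2)) (t, x) :=
    (ContDiff.fderiv_right hu (m := ∞) (by simp)).differentiable (by simp) _
  rw [h1, h2, fderiv_clm_apply hd (by fun_prop), fderiv_clm_apply hd (by fun_prop)]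
  have hs : IsSymmSndFDerivAt ℝ (fun p : ℝ × ℝ => u p.1 p.2) (t, x) :=
    (ContDiff.contDiffAt hu).isSymmSndFDerivAt (n := ∞)
      (by rw [minSmoothness_of_isRCLikeNormedField]; exact WithTop.coe_le_coe.2 le_top)
  simpa using hs.eq (0, 1) (1, 0)

theorem continuous_uncurry (hu : Smooth2 u) : Continuous (fun p : ℝ × ℝ => u p.1 p.2) :=
  ContDiff.continuous hu

theorem continuous_comp {X : Type*} [TopologicalSpace X] (hu : Smooth2 u) {f g : X → ℝ}
    (hf : Continuous f) (hg : Continuous g) : Continuous (fun z => u (f z) (g z)) :=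
  hu.continuous_uncurry.comp (hf.prodMk hg)

theorem exists_bound (hu : Smooth2 u) (T : ℝ) :
    ∃ K : ℝ, 0 ≤ K ∧ ∀ t ∈ Icc 0 T, ∀ x ∈ Icc (-1 : ℝ) 0, |u t x| ≤ K := by
  obtain ⟨K, hK⟩ := ((isCompact_Icc (a := (0 : ℝ)) (b := T)).prod
    (isCompact_Icc (a := (-1 : ℝ)) (b := 0))).exists_bound_of_continuousOn
      hu.continuous_uncurry.continuousOn
  refine ⟨max K 0, le_max_right _ _, fun t ht x hx => ?_⟩
  exact (hK (t, x) ⟨ht, hx⟩).trans (le_max_left _ _)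

end Smooth2

/-- Differentiation under the integral sign over `[-1, 0]`. -/
theorem hasDerivAt_integral_slab {T : ℝ} {u u' : ℝ → ℝ → ℝ}
    (hu : ∀ t ∈ Ioo 0 T, Continuous (u t))
    (hd : ∀ t ∈ Ioo 0 T, ∀ x, HasDerivAt (fun s => u s x) (u' t x) t)
    (hc : ContinuousOn (fun p : ℝ × ℝ => u' p.1 p.2) (Ioo 0 T ×ˢ univ))
    {t : ℝ} (ht : t ∈ Ioo 0 T) :
    HasDerivAt (fun s => ∫ x in (-1 : ℝ)..0, u s x) (∫ x in (-1 : ℝ)..0, u' t x) t := by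
  obtain ⟨c, d, htcd, hcd⟩ : ∃ c d, t ∈ Ioo c d ∧ Icc c d ⊆ Ioo 0 T := by
    refine ⟨t / 2, (t + T) / 2, ⟨?_, ?_⟩, fun s hs => ⟨?_, ?_⟩⟩
    all_goals first | linarith [ht.1, ht.2] | linarith [ht.1, ht.2, hs.1, hs.2]
  have hsub : Icc c d ×ˢ Icc (-1 : ℝ) 0 ⊆ Ioo 0 T ×ˢ univ := prod_mono hcd (subset_univ _)
  obtain ⟨K, hK⟩ := ((isCompact_Icc (a := c) (b := d)).prod
    (isCompact_Icc (a := (-1 : ℝ)) (b := 0))).exists_bound_of_continuousOn (hc.mono hsub)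
  have hcu : Continuous (u' t) := by
    rw [← continuousOn_univ]
    exact hc.comp (f := fun x => (t, x)) (by fun_prop) (fun x _ => ⟨ht, mem_univ _⟩)
  refine (intervalIntegral.hasDerivAt_integral_of_dominated_loc_of_deriv_le
    (s := Ioo c d) (bound := fun _ => K) (Ioo_mem_nhds htcd.1 htcd.2) ?_
    ((hu t ht).intervalIntegrable _ _) hcu.aestronglyMeasurable ?_ (by simp) ?_).2
  · filter_upwards [Ioo_mem_nhds ht.1 ht.2] with s hs
    exact (hu s hs).aestronglyMeasurable
  · refine Filter.Eventually.of_forall fun x hx s hs => ?_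
    rw [uIoc_of_le (by norm_num)] at hx
    exact hK (s, x) ⟨Ioo_subset_Icc_self hs, Ioc_subset_Icc_self hx⟩
  · exact Filter.Eventually.of_forall fun x _ s hs => hd s (hcd (Ioo_subset_Icc_self hs)) x

/-- A function vanishing at both ends of `(0, T)` with derivative at most `r` forces `∫ r ≥ 0`. -/
theorem integral_nonneg_of_deriv_le {T : ℝ} (hT : 0 < T) {G G' r : ℝ → ℝ}
    (hG : ∀ t ∈ Ioo 0 T, HasDerivAt G (G' t) t)
    (h0 : Filter.Tendsto G (𝓝[>] 0) (𝓝 0)) (h1 : Filter.Tendsto G (𝓝[<] T) (𝓝 0))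
    (hr : IntegrableOn r (Icc 0 T)) (hle : ∀ t ∈ Ioo 0 T, G' t ≤ r t) :
    0 ≤ ∫ t in (0 : ℝ)..T, r t := by
  have hGc : ContinuousOn G (Ioo 0 T) := fun t ht => (hG t ht).continuousAt.continuousWithinAt
  have key := sub_le_integral_of_hasDeriv_right_of_le (g := extendFrom (Ioo 0 T) G) (g' := G')
    hT.le (continuousOn_Icc_extendFrom_Ioo hGc h0 h1) (fun t ht => ?_) hr hle
  · rwa [eq_lim_at_left_extendFrom_Ioo hT h0, eq_lim_at_right_extendFrom_Ioo hT h1,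
      sub_zero] at key
  · refine HasDerivAt.hasDerivWithinAt ((hG t ht).congr_of_eventuallyEq ?_)
    filter_upwards [Ioo_mem_nhds ht.1 ht.2] with s hs
    exact extendFrom_extends hGc s hs
/-- The adjoint system with the equation extended up to the boundary in space. -/
structure AdjSys (T ε a : ℝ) (v : ℝ → ℝ → ℝ) : Prop where
  smooth : Smooth2 v
  pde : ∀ t ∈ Ioo 0 T, ∀ x ∈ Icc (-1 : ℝ) 0,
    Dt v t x + Dx v t x + ε * Dx (Dx v) t x - a * v t x = 0
  right : ∀ t ∈ Ioo 0 T, ε * (Dt v t 0 - Dx v t 0) - v t 0 = 0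
  left : ∀ t ∈ Ioo 0 T, Dt v t (-1) + Dx v t (-1) = 0

theorem IsAdjSol1D.adjSys {T ε a : ℝ} {φ : ℝ → ℝ → ℝ} (h : IsAdjSol1D T ε a φ) :
    AdjSys T ε a φ := by
  obtain ⟨hs, hp, hr, hl⟩ := h
  have hs : Smooth2 φ := hs
  refine ⟨hs, fun t ht => ?_, hr, hl⟩
  have hcont : Continuous fun x => Dt φ t x + Dx φ t x + ε * Dx (Dx φ) t x - a * φ t x := by
    have h1 := hs.dt.continuous_comp (continuous_const (y := t)) continuous_id
    have h2 := hs.dx.continuous_comp (continuous_const (y := t)) continuous_id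
    have h3 := hs.dx.dx.continuous_comp (continuous_const (y := t)) continuous_id
    have h4 := hs.continuous_comp (continuous_const (y := t)) continuous_id
    exact ((h1.add h2).add (h3.const_mul ε)).sub (h4.const_mul a)
  have hcl : closure (Ioo (-1 : ℝ) 0) = Icc (-1) 0 := closure_Ioo (by norm_num)
  intro x hx
  exact closure_minimal (fun y hy => hp t ht y hy) (isClosed_singleton.preimage hcont)
    (hcl.symm ▸ hx)

theorem HasDerivAt.eq_zero_of_forall_Ioo {T : ℝ} {f : ℝ → ℝ} {f' t : ℝ} (ht : t ∈ Ioo 0 T)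
    (hf : HasDerivAt f f' t) (h : ∀ s ∈ Ioo 0 T, f s = 0) : f' = 0 :=
  hf.unique ((hasDerivAt_const t (0 : ℝ)).congr_of_eventuallyEq (by
    filter_upwards [Ioo_mem_nhds ht.1 ht.2] with s hs using h s hs))

theorem HasDerivAt.of_eq {f g : ℝ → ℝ} {f' g' t : ℝ} (h : HasDerivAt f f' t)
    (hf : ∀ s, g s = f s) (hf' : g' = f') : HasDerivAt g g' t := by
  rw [funext hf, hf']
  exact h

namespace AdjSys

variable {T ε a : ℝ} {v : ℝ → ℝ → ℝ}

theorem dt (h : AdjSys T ε a v) : AdjSys T ε a (Dt v) where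
  smooth := h.smooth.dt
  pde t ht x hx := by
    have hs := h.smooth
    rw [hs.Dx_Dt, hs.dx.Dx_Dt]
    exact HasDerivAt.eq_zero_of_forall_Ioo ht
      ((((hs.dt.hasDerivAt_t t x).add (hs.dx.hasDerivAt_t t x)).add
        ((hs.dx.dx.hasDerivAt_t t x).const_mul ε)).sub ((hs.hasDerivAt_t t x).const_mul a))
      (fun s hs => h.pde s hs x hx)
  right t ht := by
    have hs := h.smooth
    rw [hs.Dx_Dt]
    exact HasDerivAt.eq_zero_of_forall_Ioo ht
      ((((hs.dt.hasDerivAt_t t 0).sub (hs.dx.hasDerivAt_t t 0)).const_mul ε).sub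
        (hs.hasDerivAt_t t 0)) (fun s hs => h.right s hs)
  left t ht := by
    have hs := h.smooth
    rw [hs.Dx_Dt]
    exact HasDerivAt.eq_zero_of_forall_Ioo ht
      ((hs.dt.hasDerivAt_t t (-1)).add (hs.dx.hasDerivAt_t t (-1))) (fun s hs => h.left s hs)

end AdjSys

theorem Smooth2.hasDerivAt_integral_mul {u v : ℝ → ℝ → ℝ} (hu : Smooth2 u) (hv : Smooth2 v)
    (t : ℝ) : HasDerivAt (fun s => ∫ x in (-1 : ℝ)..0, u s x * v s x)
      (∫ x in (-1 : ℝ)..0, (Dt u t x * v t x + u t x * Dt v t x)) t := by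
  have hc := hu.continuous_uncurry
  have hc' := hv.continuous_uncurry
  have hd := hu.dt.continuous_uncurry
  have hd' := hv.dt.continuous_uncurry
  have key := hasDerivAt_integral_slab (T := 2) (t := 1)
    (u := fun s x => u (s + (t - 1)) x * v (s + (t - 1)) x)
    (u' := fun s x => Dt u (s + (t - 1)) x * v (s + (t - 1)) x
      + u (s + (t - 1)) x * Dt v (s + (t - 1)) x)
    (fun s _ => (hu.continuous_comp continuous_const continuous_id).mul
      (hv.continuous_comp continuous_const continuous_id))
    (fun s _ x => ((hu.hasDerivAt_t _ x).comp_add_const s (t - 1)).mul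
      ((hv.hasDerivAt_t _ x).comp_add_const s (t - 1)))
    (by
      have e : Continuous fun p : ℝ × ℝ => p.1 + (t - 1) := by fun_prop
      exact (((hu.dt.continuous_comp e continuous_snd).mul
        (hv.continuous_comp e continuous_snd)).add ((hu.continuous_comp e continuous_snd).mul
        (hv.dt.continuous_comp e continuous_snd))).continuousOn)
    (by constructor <;> norm_num)
  have := HasDerivAt.comp_sub_const (f := fun s => ∫ x in (-1 : ℝ)..0,
    u (s + (t - 1)) x * v (s + (t - 1)) x) t (t - 1) (by simpa using key)
  simpa using this

/-- The gradient energy of the adjoint system. -/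
def gradEnergy (ε a : ℝ) (v : ℝ → ℝ → ℝ) (t : ℝ) : ℝ :=
  (ε * (∫ x in (-1 : ℝ)..0, Dx v t x * Dx v t x) + a * (∫ x in (-1 : ℝ)..0, v t x * v t x)
    + v t 0 ^ 2) / 2

namespace AdjSys

variable {T ε a : ℝ} {v : ℝ → ℝ → ℝ}

theorem hasDerivAt_X1normSq (h : AdjSys T ε a v) {t : ℝ} (ht : t ∈ Ioo 0 T) :
    HasDerivAt (fun s => X1normSq ε (v s))
      (4 * gradEnergy ε a v t - v t 0 ^ 2 + v t (-1) ^ 2) t := by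
  have hs := h.smooth
  have c := hs.continuous_comp (continuous_const (y := t)) continuous_id
  have ct := hs.dt.continuous_comp (continuous_const (y := t)) continuous_id
  have cx := hs.dx.continuous_comp (continuous_const (y := t)) continuous_id
  have cxx := hs.dx.dx.continuous_comp (continuous_const (y := t)) continuous_id
  simp only [id] at c ct cx cxx
  have hd := (hs.hasDerivAt_integral_mul hs t).add
    ((((hs.hasDerivAt_t t 0).pow 2).add ((hs.hasDerivAt_t t (-1)).pow 2)).const_mul ε)
  have hftc : ∫ x in (-1 : ℝ)..0, (2 * (v t x * Dx v t x) + 2 * ε * (Dx v t x * Dx v t x)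
      + 2 * ε * (v t x * Dx (Dx v) t x))
      = (v t 0 * v t 0 + 2 * ε * (v t 0 * Dx v t 0))
        - (v t (-1) * v t (-1) + 2 * ε * (v t (-1) * Dx v t (-1))) := by
    refine integral_eq_sub_of_hasDerivAt (f := fun x => v t x * v t x + 2 * ε * (v t x * Dx v t x))
      (fun x _ => ?_) (Continuous.intervalIntegrable (by fun_prop) _ _)
    exact (((hs.hasDerivAt_x t x).mul (hs.hasDerivAt_x t x)).add
      (((hs.hasDerivAt_x t x).mul (hs.dx.hasDerivAt_x t x)).const_mul (2 * ε))).of_eq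
      (fun _ => rfl) (by ring)
  have hint : ∫ x in (-1 : ℝ)..0, (Dt v t x * v t x + v t x * Dt v t x)
      = 2 * a * (∫ x in (-1 : ℝ)..0, v t x * v t x)
        + 2 * ε * (∫ x in (-1 : ℝ)..0, Dx v t x * Dx v t x)
        - ∫ x in (-1 : ℝ)..0, (2 * (v t x * Dx v t x) + 2 * ε * (Dx v t x * Dx v t x)
          + 2 * ε * (v t x * Dx (Dx v) t x)) := by
    rw [← intervalIntegral.integral_const_mul, ← intervalIntegral.integral_const_mul,
      ← intervalIntegral.integral_add, ← intervalIntegral.integral_sub]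
    · refine intervalIntegral.integral_congr fun x hx => ?_
      rw [uIcc_of_le (by norm_num)] at hx
      linear_combination 2 * v t x * h.pde t ht x hx
    all_goals exact Continuous.intervalIntegrable (by fun_prop) _ _
  rw [hint, hftc] at hd
  refine hd.of_eq (fun s => by simp [X1normSq, sq]) ?_
  simp only [gradEnergy, Nat.cast_ofNat, Nat.add_one_sub_one, pow_one]
  linear_combination (-2 * v t 0) * h.right t ht + (-2 * ε * v t (-1)) * h.left t ht

theorem hasDerivAt_gradEnergy (h : AdjSys T ε a v) {t : ℝ} (ht : t ∈ Ioo 0 T) :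
    HasDerivAt (gradEnergy ε a v)
      (X1normSq ε (Dt v t) + ∫ x in (-1 : ℝ)..0, Dx v t x * Dt v t x) t := by
  have hs := h.smooth
  have c := hs.continuous_comp (continuous_const (y := t)) continuous_id
  have ct := hs.dt.continuous_comp (continuous_const (y := t)) continuous_id
  have cx := hs.dx.continuous_comp (continuous_const (y := t)) continuous_id
  have cxx := hs.dx.dx.continuous_comp (continuous_const (y := t)) continuous_id
  have cxt := hs.dx.dt.continuous_comp (continuous_const (y := t)) continuous_id
  simp only [id] at c ct cx cxx cxt
  have hd := ((((hs.dx.hasDerivAt_integral_mul hs.dx t).const_mul ε).add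
    ((hs.hasDerivAt_integral_mul hs t).const_mul a)).add
    ((hs.hasDerivAt_t t 0).pow 2)).div_const 2
  have hftc : ∫ x in (-1 : ℝ)..0, (ε * (Dx (Dx v) t x * Dt v t x)
      + ε * (Dx v t x * Dt (Dx v) t x))
      = ε * (Dx v t 0 * Dt v t 0) - ε * (Dx v t (-1) * Dt v t (-1)) := by
    refine integral_eq_sub_of_hasDerivAt (f := fun x => ε * (Dx v t x * Dt v t x))
      (fun x _ => ?_) (Continuous.intervalIntegrable (by fun_prop) _ _)
    exact (((hs.dx.hasDerivAt_x t x).mul (hs.dt.hasDerivAt_x t x)).const_mul ε).of_eq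
      (fun _ => rfl) (by rw [hs.Dx_Dt]; ring)
  have hint : ε * (∫ x in (-1 : ℝ)..0, (Dt (Dx v) t x * Dx v t x + Dx v t x * Dt (Dx v) t x))
      + a * (∫ x in (-1 : ℝ)..0, (Dt v t x * v t x + v t x * Dt v t x))
      = 2 * (∫ x in (-1 : ℝ)..0, (ε * (Dx (Dx v) t x * Dt v t x)
          + ε * (Dx v t x * Dt (Dx v) t x)))
        + 2 * (∫ x in (-1 : ℝ)..0, Dt v t x ^ 2)
        + 2 * ∫ x in (-1 : ℝ)..0, Dx v t x * Dt v t x := by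
    simp only [← intervalIntegral.integral_const_mul]
    rw [← intervalIntegral.integral_add, ← intervalIntegral.integral_add,
      ← intervalIntegral.integral_add]
    · refine intervalIntegral.integral_congr fun x hx => ?_
      rw [uIcc_of_le (by norm_num)] at hx
      linear_combination -2 * Dt v t x * h.pde t ht x hx
    all_goals exact Continuous.intervalIntegrable (by fun_prop) _ _
  rw [hint, hftc] at hd
  refine hd.of_eq (fun s => by simp [gradEnergy]) ?_
  simp only [X1normSq, Nat.cast_ofNat, Nat.add_one_sub_one, pow_one]
  linear_combination Dt v t 0 * h.right t ht + ε * Dt v t (-1) * h.left t ht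

end AdjSys
/-- A time weight `l` with derivatives `l1`, `l2`, large and slowly varying at the parabolic scale
given by `ε`, and blowing up at both ends of `(0, T)`. -/
structure TimeWeight (T ε a : ℝ) (l l1 l2 : ℝ → ℝ) : Prop where
  eps_pos : 0 < ε
  eps_lt_one : ε < 1
  a_nonneg : 0 ≤ a
  deriv1 : ∀ t ∈ Ioo 0 T, HasDerivAt l (l1 t) t
  deriv2 : ∀ t ∈ Ioo 0 T, HasDerivAt l1 (l2 t) t
  cont2 : ContinuousOn l2 (Ioo 0 T)
  large : ∀ t ∈ Ioo 0 T, 1000 ≤ ε * l t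
  bound1 : ∀ t ∈ Ioo 0 T, 1000 * |l1 t| ≤ ε * l t ^ 2
  bound2 : ∀ t ∈ Ioo 0 T, 1000 * |l2 t| ≤ ε ^ 2 * l t ^ 3
  bounda : ∀ t ∈ Ioo 0 T, 1000 * a ≤ ε * l t ^ 2
  tendsto_left : Filter.Tendsto l (𝓝[>] 0) Filter.atTop
  tendsto_right : Filter.Tendsto l (𝓝[<] T) Filter.atTop

/-- The weight `y^m * exp (-2 c y)`. -/
def expWeight (c : ℝ) (m : ℤ) (y : ℝ) : ℝ := y ^ m * exp (-(2 * c * y))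

theorem expWeight_pos {c : ℝ} {m : ℤ} {y : ℝ} (hy : 0 < y) : 0 < expWeight c m y := by
  unfold expWeight; positivity

theorem expWeight_add_nat {c : ℝ} (m : ℤ) (k : ℕ) {y : ℝ} (hy : 0 < y) :
    expWeight c (m + k) y = y ^ k * expWeight c m y := by
  unfold expWeight
  rw [zpow_add₀ hy.ne', zpow_natCast]; ring

namespace TimeWeight

variable {T ε a : ℝ} {l l1 l2 : ℝ → ℝ}

theorem pos (h : TimeWeight T ε a l l1 l2) {t : ℝ} (ht : t ∈ Ioo 0 T) : 0 < l t := by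
  have h1 := h.large t ht
  have h2 := h.eps_pos
  by_contra! h3
  nlinarith

theorem one_le (h : TimeWeight T ε a l l1 l2) {t : ℝ} (ht : t ∈ Ioo 0 T) : 1000 ≤ l t := by
  have h1 := h.large t ht
  have h2 := h.eps_lt_one
  nlinarith [h.pos ht]

theorem hasDerivAt_expWeight (h : TimeWeight T ε a l l1 l2) {c : ℝ} (hc0 : 0 ≤ c) (hc : c ≤ 20)
    {m : ℤ} (hm : |(m : ℝ)| ≤ 5) {t : ℝ} (ht : t ∈ Ioo 0 T) :
    ∃ D, HasDerivAt (fun s => expWeight c m (l s)) D t ∧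
      |D| ≤ ε * l t ^ 2 * expWeight c m (l t) := by
  have hl := h.pos ht
  have h1 := h.one_le ht
  refine ⟨expWeight c m (l t) * (l1 t * (m / l t - 2 * c)), ?_, ?_⟩
  · have hz := (hasDerivAt_zpow m (l t) (Or.inl hl.ne')).comp t (h.deriv1 t ht)
    have he := (((h.deriv1 t ht).const_mul (2 * c)).neg).exp
    refine (hz.mul he).of_eq (fun s => rfl) ?_
    simp only [expWeight, Function.comp, Pi.neg_apply]
    rw [zpow_sub_one₀ hl.ne']
    field_simp
    ring
  · rw [abs_mul, abs_of_pos (expWeight_pos hl), mul_comm]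
    refine mul_le_mul_of_nonneg_right ?_ (expWeight_pos hl).le
    rw [abs_mul]
    have h2 : |(m : ℝ) / l t - 2 * c| ≤ 45 := by
      have h3 : |(m : ℝ) / l t| ≤ 5 := by
        rw [abs_div, abs_of_pos hl, div_le_iff₀ hl]; linarith
      rw [abs_le] at h3 ⊢
      constructor <;> linarith [h3.1, h3.2]
    have h3 := h.bound1 t ht
    nlinarith [abs_nonneg (l1 t), abs_nonneg ((m : ℝ) / l t - 2 * c)]

end TimeWeight

/-- Weighted energy functional whose dissipation controls the time derivative. -/
def energyY (ε a : ℝ) (l : ℝ → ℝ) (c : ℝ) (m : ℤ) (v : ℝ → ℝ → ℝ) (t : ℝ) : ℝ :=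
  expWeight c m (l t) * gradEnergy ε a v t
    + ε / 2 * (expWeight c (m + 2) (l t) * X1normSq ε (v t))

theorem X1normSq_nonneg {ε : ℝ} (hε : 0 ≤ ε) (ψ : ℝ → ℝ) : 0 ≤ X1normSq ε ψ := by
  have : 0 ≤ ∫ x in (-1 : ℝ)..0, ψ x ^ 2 :=
    intervalIntegral.integral_nonneg (by norm_num) fun x _ => sq_nonneg _
  unfold X1normSq; positivity

theorem AdjSys.exists_deriv_energyY {T ε a : ℝ} {l l1 l2 : ℝ → ℝ}
    (h : TimeWeight T ε a l l1 l2) {v : ℝ → ℝ → ℝ} (hv : AdjSys T ε a v)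
    {c : ℝ} (hc0 : 0 ≤ c) (hc : c ≤ 20) {m : ℤ} (hm : |(m : ℝ)| ≤ 5)
    (hm2 : |((m + 2 : ℤ) : ℝ)| ≤ 5) {t : ℝ} (ht : t ∈ Ioo 0 T) :
    ∃ D, HasDerivAt (energyY ε a l c m v) D t ∧
      expWeight c m (l t) * X1normSq ε (Dt v t) / 2
        ≤ D + ε ^ 2 * (expWeight c (m + 4) (l t) * X1normSq ε (v t)) := by
  obtain ⟨D1, hD1, hb1⟩ := h.hasDerivAt_expWeight hc0 hc hm ht
  obtain ⟨D2, hD2, hb2⟩ := h.hasDerivAt_expWeight hc0 hc hm2 ht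
  refine ⟨_, (hD1.mul (hv.hasDerivAt_gradEnergy ht)).add
    ((hD2.mul (hv.hasDerivAt_X1normSq ht)).const_mul (ε / 2)), ?_⟩
  have hl := h.pos ht
  have hε := h.eps_pos
  have hlarge := h.large t ht
  have hs := hv.smooth
  have e2 : expWeight c (m + 2) (l t) = l t ^ 2 * expWeight c m (l t) :=
    expWeight_add_nat m 2 hl
  have e4 : expWeight c (m + 4) (l t) = l t ^ 4 * expWeight c m (l t) :=
    expWeight_add_nat m 4 hl
  rw [e2] at hb2
  simp only [e2, e4]
  have hρ : 0 < expWeight c m (l t) := expWeight_pos hl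
  set ρ := expWeight c m (l t) with hρdef
  clear_value ρ
  have ct := hs.dt.continuous_comp (continuous_const (y := t)) continuous_id
  have cx := hs.dx.continuous_comp (continuous_const (y := t)) continuous_id
  simp only [id] at ct cx
  have hcross : -((∫ x in (-1 : ℝ)..0, Dx v t x * Dx v t x) + ∫ x in (-1 : ℝ)..0, Dt v t x ^ 2)
      ≤ 2 * ∫ x in (-1 : ℝ)..0, Dx v t x * Dt v t x := by
    rw [← intervalIntegral.integral_add, ← intervalIntegral.integral_neg,
      ← intervalIntegral.integral_const_mul]
    · refine intervalIntegral.integral_mono_on (by norm_num) ?_ ?_ fun x _ => ?_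
      · exact Continuous.intervalIntegrable (by fun_prop) _ _
      · exact Continuous.intervalIntegrable (by fun_prop) _ _
      · nlinarith [sq_nonneg (Dx v t x + Dt v t x)]
    all_goals exact Continuous.intervalIntegrable (by fun_prop) _ _
  have hDx : 0 ≤ ∫ x in (-1 : ℝ)..0, Dx v t x * Dx v t x :=
    intervalIntegral.integral_nonneg (by norm_num) fun x _ => mul_self_nonneg _
  have hV : 0 ≤ ∫ x in (-1 : ℝ)..0, v t x * v t x :=
    intervalIntegral.integral_nonneg (by norm_num) fun x _ => mul_self_nonneg _
  have hVt : 0 ≤ ∫ x in (-1 : ℝ)..0, Dt v t x ^ 2 :=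
    intervalIntegral.integral_nonneg (by norm_num) fun x _ => sq_nonneg _
  have ha := h.a_nonneg
  have hJ : 0 ≤ gradEnergy ε a v t := by unfold gradEnergy; positivity
  have hX : 0 ≤ X1normSq ε (v t) := X1normSq_nonneg hε.le _
  have k1 : -(ε * l t ^ 2 * ρ * gradEnergy ε a v t) ≤ D1 * gradEnergy ε a v t := by
    rw [← neg_mul]
    exact mul_le_mul_of_nonneg_right (abs_le.1 hb1).1 hJ
  have k2 : -(ε * l t ^ 2 * (l t ^ 2 * ρ) * X1normSq ε (v t)) ≤ D2 * X1normSq ε (v t) := by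
    rw [← neg_mul]
    exact mul_le_mul_of_nonneg_right (abs_le.1 hb2).1 hX
  have hel : 1 ≤ (ε * l t) ^ 2 := one_le_pow₀ (by linarith)
  have k3 : ρ * (∫ x in (-1 : ℝ)..0, Dx v t x * Dx v t x)
      ≤ ε * l t ^ 2 * ρ * (ε * ∫ x in (-1 : ℝ)..0, Dx v t x * Dx v t x) := by
    have := mul_le_mul_of_nonneg_right hel (mul_nonneg hρ.le hDx)
    nlinarith
  have k4 : 0 ≤ ε ^ 2 * (l t ^ 4 * ρ * X1normSq ε (v t)) := by positivity
  have k5 : ρ * -((∫ x in (-1 : ℝ)..0, Dx v t x * Dx v t x) + ∫ x in (-1 : ℝ)..0, Dt v t x ^ 2)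
      ≤ ρ * (2 * ∫ x in (-1 : ℝ)..0, Dx v t x * Dt v t x) :=
    mul_le_mul_of_nonneg_left hcross hρ.le
  have k6 : 0 ≤ ρ * (ε * (Dt v t 0 ^ 2 + Dt v t (-1) ^ 2)) := by positivity
  have k7 : 0 ≤ ε * (l t ^ 2 * ρ) * v t (-1) ^ 2 := by positivity
  have k8 : 0 ≤ ε * l t ^ 2 * ρ * (a * ∫ x in (-1 : ℝ)..0, v t x * v t x) := by positivity
  have eX : X1normSq ε (Dt v t) = (∫ x in (-1 : ℝ)..0, Dt v t x ^ 2)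
    + ε * (Dt v t 0 ^ 2 + Dt v t (-1) ^ 2) := rfl
  have eJ : gradEnergy ε a v t = (ε * (∫ x in (-1 : ℝ)..0, Dx v t x * Dx v t x)
    + a * (∫ x in (-1 : ℝ)..0, v t x * v t x) + v t 0 ^ 2) / 2 := rfl
  have m2 := mul_le_mul_of_nonneg_left k2 (half_pos hε).le
  rw [eX]
  rw [eJ] at k1 ⊢
  linarith
theorem exp_one_sub_bounds {x : ℝ} (hx : x ∈ Icc (-1 : ℝ) 0) :
    2 ≤ exp (1 - x) ∧ exp (1 - x) ≤ 8 ∧ 0 ≤ exp 3 - exp (1 - x) ∧ exp 3 - exp (1 - x) ≤ 19 := by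
  have h1 := Real.exp_one_gt_d9
  have h2 := Real.exp_one_lt_d9
  have e2 : exp 2 = exp 1 ^ 2 := by rw [← Real.exp_nat_mul]; norm_num
  have e3 : exp 3 = exp 1 ^ 3 := by rw [← Real.exp_nat_mul]; norm_num
  have l1 : exp 1 ≤ exp (1 - x) := Real.exp_le_exp.2 (by linarith [hx.2])
  have l2 : exp (1 - x) ≤ exp 2 := Real.exp_le_exp.2 (by linarith [hx.1])
  have b2 : exp 1 ^ 2 ≤ 2.72 ^ 2 := by gcongr; linarith
  have b3 : exp 1 ^ 3 ≤ 2.72 ^ 3 := by gcongr; linarith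
  have b3' : (2.71 : ℝ) ^ 3 ≤ exp 1 ^ 3 := by gcongr; linarith
  rw [← e2] at b2
  rw [← e3] at b3 b3'
  norm_num at b2 b3 b3'
  refine ⟨?_, ?_, ?_, ?_⟩ <;> linarith

theorem abs_mul_le_mul {x y A B : ℝ} (hx : |x| ≤ A) (hy : |y| ≤ B) : |x * y| ≤ A * B := by
  rw [abs_mul]
  exact mul_le_mul hx hy (abs_nonneg y) ((abs_nonneg x).trans hx)

/-- Sizes of the coefficients, relative to powers of `l`. -/
structure ScaledBounds (l b p r h k d : ℝ) : Prop where
  l_ge : 1000 ≤ l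
  b_pos : 0 < b
  b_le : 1000 * b ≤ l
  p_le : 1000 * |p| ≤ l ^ 2
  r_le : 1000 * |r| ≤ l ^ 3
  h_nonneg : 0 ≤ h
  h_le : 1000 * h ≤ l ^ 2
  k_ge : 2 ≤ k
  k_le : k ≤ 8
  d_nonneg : 0 ≤ d
  d_le : d ≤ 19

namespace ScaledBounds

variable {l b p r h k d : ℝ}

/-- Rescaling of the coefficients to bounded quantities. -/
theorem exists_scaled (H : ScaledBounds l b p r h k d) :
    ∃ b' p' r' h' c' : ℝ, b = l * b' ∧ p = l ^ 2 * p' ∧ r = l ^ 3 * r' ∧ h = l ^ 2 * h' ∧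
      l * c' = 1 ∧ |b'| ≤ 1 / 1000 ∧ |p'| ≤ 1 / 1000 ∧ |r'| ≤ 1 / 1000 ∧ |h'| ≤ 1 / 1000 ∧
      |c'| ≤ 1 / 1000 ∧ 0 ≤ b' := by
  have hl : 0 < l := by linarith [H.l_ge]
  refine ⟨b / l, p / l ^ 2, r / l ^ 3, h / l ^ 2, 1 / l, ?_, ?_, ?_, ?_, ?_, ?_, ?_, ?_, ?_, ?_,
    div_nonneg H.b_pos.le hl.le⟩
  iterate 5 · field_simp
  all_goals
    rw [abs_div]
    nth_rw 2 [abs_of_pos (by positivity)]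
    rw [div_le_div_iff₀ (by positivity) (by norm_num)]
  · rw [abs_of_pos H.b_pos]; linarith [H.b_le]
  · linarith [H.p_le]
  · linarith [H.r_le]
  · rw [abs_of_nonneg H.h_nonneg]; linarith [H.h_le]
  · rw [abs_one]; linarith [H.l_ge]

theorem bulk (H : ScaledBounds l b p r h k d) :
    (l * k) ^ 3 ≤ -(p * l * k ^ 2 - p * k / 2 + r * d / 2 + b * p * k / 2)
      + l * k * ((l * k) ^ 2 - l * k + (p * d + b * (l * k) - h))
      + (2 * (l * k) ^ 2 - l * k - p * k + b * (l * k)) * (2 * (l * k) + b) / 2 := by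
  obtain ⟨b', p', r', h', c', rfl, rfl, rfl, rfl, hc, hb', hp', hr', hh', hc', hb0⟩ :=
    H.exists_scaled
  have hl : 0 < l := by linarith [H.l_ge]
  have hk : |k| ≤ 8 := by rw [abs_of_nonneg] <;> linarith [H.k_ge, H.k_le]
  have hd : |d| ≤ 19 := by rw [abs_of_nonneg H.d_nonneg]; exact H.d_le
  have hkk := abs_mul_le_mul hk hk
  have t1 := abs_le.1 (abs_mul_le_mul hp' hkk)
  have t2 := abs_le.1 (abs_mul_le_mul (abs_mul_le_mul hp' hk) hc')
  have t3 := abs_le.1 (abs_mul_le_mul hr' hd)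
  have t4 := abs_le.1 (abs_mul_le_mul (abs_mul_le_mul hb' hp') hk)
  have t5 := abs_le.1 (abs_mul_le_mul hc' hkk)
  have t6 := abs_le.1 (abs_mul_le_mul (abs_mul_le_mul hp' hd) hk)
  have t7 := abs_le.1 (abs_mul_le_mul hh' hk)
  have t8 := abs_le.1 (abs_mul_le_mul (abs_mul_le_mul hb' hk) hc')
  have t9 := abs_le.1 (abs_mul_le_mul hb' hkk)
  have t10 := abs_le.1 (abs_mul_le_mul (abs_mul_le_mul hb' hb') hk)
  have hk3 : 8 ≤ k ^ 3 := by
    have : (2 : ℝ) ^ 3 ≤ k ^ 3 := pow_le_pow_left₀ (by norm_num) H.k_ge 3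
    linarith
  have key : 0 ≤ l ^ 3 * (2 * k ^ 3 - 2 * (p' * (k * k)) + p' * k * c' / 2 - r' * d / 2
      - b' * p' * k - 2 * (c' * (k * k)) + p' * d * k - h' * k - b' * k * c' / 2
      + 3 * (b' * (k * k)) + b' * b' * k / 2) := by
    refine mul_nonneg (by positivity) ?_
    linarith [t1.1, t1.2, t2.1, t2.2, t3.1, t3.2, t4.1, t4.2, t5.1, t5.2, t6.1, t6.2, t7.1, t7.2,
      t8.1, t8.2, t9.1, t9.2, t10.1, t10.2]
  linear_combination key + (p' * k * l ^ 2 / 2 - 2 * k ^ 2 * l ^ 2 - b' * k * l ^ 2 / 2) * hc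

theorem zero_order_bounds (H : ScaledBounds l b p r h k d) :
    9 / 10 * (l * k) ^ 2 ≤ (l * k) ^ 2 - l * k + (p * d + b * (l * k) - h) ∧
      (l * k) ^ 2 - l * k + (p * d + b * (l * k) - h) ≤ 65 * l ^ 2 := by
  obtain ⟨b', p', r', h', c', rfl, rfl, rfl, rfl, hc, hb', hp', hr', hh', hc', hb0⟩ :=
    H.exists_scaled
  have hl : 0 < l := by linarith [H.l_ge]
  have hk : |k| ≤ 8 := by rw [abs_of_nonneg] <;> linarith [H.k_ge, H.k_le]
  have hd : |d| ≤ 19 := by rw [abs_of_nonneg H.d_nonneg]; exact H.d_le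
  have t1 := abs_le.1 (abs_mul_le_mul hk hc')
  have t2 := abs_le.1 (abs_mul_le_mul hp' hd)
  have t3 := abs_le.1 (abs_mul_le_mul hb' hk)
  have t4 := abs_le.1 hh'
  have hk2 : 4 ≤ k ^ 2 := by nlinarith [H.k_ge]
  have hk2' : k ^ 2 ≤ 64 := by nlinarith [H.k_le, H.k_ge]
  constructor
  · have key : 0 ≤ l ^ 2 * (k ^ 2 / 10 - k * c' + p' * d + b' * k - h') := by
      refine mul_nonneg (by positivity) ?_
      linarith [t1.2, t2.1, t3.1, t4.2]
    linear_combination key - l * k * hc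
  · have key : 0 ≤ l ^ 2 * (65 - k ^ 2 + k * c' - p' * d - b' * k + h') := by
      refine mul_nonneg (by positivity) ?_
      linarith [t1.1, t2.2, t3.2, t4.1]
    linear_combination key + l * k * hc

theorem flux_right (H : ScaledBounds l b p r h k d) (y z : ℝ) :
    (l * k) ^ 3 * y ^ 2 / 2 ≤ z * (b * z + b * (l * k) * y + b ^ 2 * y - p * d * y)
      + (l * k + b / 2) * z ^ 2
      + ((l * k) ^ 2 - l * k + (p * d + b * (l * k) - h)) * (l * k + b / 2) * y ^ 2 := by
  have hg := H.zero_order_bounds.1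
  obtain ⟨b', p', r', h', c', rfl, rfl, rfl, rfl, hc, hb', hp', hr', hh', hc', hb0⟩ :=
    H.exists_scaled
  have hl : 0 < l := by linarith [H.l_ge]
  have hk0 := H.k_ge
  have hk : |k| ≤ 8 := by rw [abs_of_nonneg] <;> linarith [H.k_ge, H.k_le]
  have hd : |d| ≤ 19 := by rw [abs_of_nonneg H.d_nonneg]; exact H.d_le
  set g := (l * k) ^ 2 - l * k + (l ^ 2 * p' * d + l * b' * (l * k) - l ^ 2 * h') with hgdef
  clear_value g
  have h1 : 9 / 10 * (l * k) ^ 3 ≤ g * (l * k + l * b' / 2) := by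
    have : 0 ≤ g := le_trans (by positivity) hg
    calc 9 / 10 * (l * k) ^ 3 = 9 / 10 * (l * k) ^ 2 * (l * k) := by ring
      _ ≤ g * (l * k) := by gcongr
      _ ≤ _ := by gcongr; nlinarith
  have t1 := abs_le.1 (abs_mul_le_mul hb' hk)
  have t2 := abs_le.1 (abs_mul_le_mul hb' hb')
  have t3 := abs_le.1 (abs_mul_le_mul hp' hd)
  have hk3 : 8 ≤ k ^ 3 := by
    have : (2 : ℝ) ^ 3 ≤ k ^ 3 := pow_le_pow_left₀ (by norm_num) H.k_ge 3
    linarith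
  set m := b' * k + b' * b' - p' * d with hm
  have hm2 : m ^ 2 ≤ 1 := by
    have : |m| ≤ 1 := abs_le.2 ⟨by linarith [t1.1, t2.1, t3.2], by linarith [t1.2, t2.2, t3.1]⟩
    rw [← sq_abs]; exact pow_le_one₀ (abs_nonneg _) this
  have h2 := mul_le_mul_of_nonneg_right h1 (sq_nonneg y)
  have h3 : 0 ≤ l * ((z + m * l * y / 2) ^ 2 + (1 - m ^ 2) * (l * y) ^ 2 / 4
      + (k - 1 + 3 * b' / 2) * z ^ 2 + (4 / 10 * k ^ 3 - 1 / 4) * (l * y) ^ 2) := by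
    have e1 : 0 ≤ 1 - m ^ 2 := by linarith
    have e2 : 0 ≤ k - 1 + 3 * b' / 2 := by linarith
    have e3 : 0 ≤ 4 / 10 * k ^ 3 - 1 / 4 := by linarith
    positivity
  rw [hm] at h3
  linarith

theorem flux_left (H : ScaledBounds l b p r h k d) (y yt z : ℝ) (hz : z = -yt - l * k * y) :
    z * (b * yt - p * d * y) + (l * k + b / 2) * z ^ 2
      + ((l * k) ^ 2 - l * k + (p * d + b * (l * k) - h)) * (l * k + b / 2) * y ^ 2
      ≤ 2500 * (l * yt ^ 2 + l ^ 3 * y ^ 2) := by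
  obtain ⟨hg0, hg⟩ := H.zero_order_bounds
  have hl : 0 < l := by linarith [H.l_ge]
  have hk0 := H.k_ge
  have hk8 := H.k_le
  have hb := H.b_le
  have hb0 := H.b_pos
  set g := (l * k) ^ 2 - l * k + (p * d + b * (l * k) - h) with hgdef
  clear_value g
  have hw : l * k + b / 2 ≤ 9 * l := by nlinarith
  have hw0 : 0 ≤ l * k + b / 2 := by positivity
  have h1 : g * (l * k + b / 2) * y ^ 2 ≤ 65 * l ^ 2 * (9 * l) * y ^ 2 := by gcongr
  have h2 : (l * k + b / 2) * z ^ 2 ≤ 9 * l * z ^ 2 := by gcongr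
  have hzz : z ^ 2 ≤ 2 * yt ^ 2 + 128 * l ^ 2 * y ^ 2 := by
    have e : (l * k * y) ^ 2 ≤ (l * 8 * y) ^ 2 := by
      rw [mul_pow, mul_pow (l * 8)]; gcongr
    rw [hz]; nlinarith [sq_nonneg (yt - l * k * y)]
  have h3 : z * (b * yt) ≤ l * (z ^ 2 + yt ^ 2) := by
    have e1 : z * yt ≤ z ^ 2 + yt ^ 2 := by nlinarith [sq_nonneg (z - yt), sq_nonneg z, sq_nonneg yt]
    calc z * (b * yt) = b * (z * yt) := by ring
      _ ≤ b * (z ^ 2 + yt ^ 2) := by gcongr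
      _ ≤ _ := by gcongr; linarith
  have h4 : -(z * (p * d * y)) ≤ l * (z ^ 2 + (l * y) ^ 2) := by
    have hpd : |p * d| ≤ l ^ 2 := by
      rw [abs_mul, abs_of_nonneg H.d_nonneg]
      nlinarith [H.p_le, H.d_le, H.d_nonneg, abs_nonneg p]
    have e1 : |z * y * l| ≤ z ^ 2 + (l * y) ^ 2 := abs_le.2
      ⟨by nlinarith [sq_nonneg (z + l * y), sq_nonneg z, sq_nonneg (l * y)],
        by nlinarith [sq_nonneg (z - l * y), sq_nonneg z, sq_nonneg (l * y)]⟩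
    calc -(z * (p * d * y)) ≤ |z * (p * d * y)| := neg_le_abs _
      _ = |p * d| * |z * y| := by rw [← abs_mul]; congr 1; ring
      _ ≤ l ^ 2 * |z * y| := by gcongr
      _ = l * |z * y * l| := by rw [abs_mul _ l, abs_of_pos hl]; ring
      _ ≤ _ := by gcongr
  have h5 : 11 * l * z ^ 2 ≤ 11 * l * (2 * yt ^ 2 + 128 * l ^ 2 * y ^ 2) := by gcongr
  have h6 : 0 ≤ l * yt ^ 2 := by positivity
  have h7 : 0 ≤ l ^ 3 * y ^ 2 := by positivity
  linarith

end ScaledBounds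
/-- The squared Carleman exponential. -/
def carlE (y x : ℝ) : ℝ := exp (-(2 * (exp 3 - exp (1 - x)) * y))

/-- The conjugated gradient `e^f ∂_x (e^{-f} φ)`. -/
def carlZ (l : ℝ → ℝ) (φ : ℝ → ℝ → ℝ) (t x : ℝ) : ℝ := Dx φ t x - l t * exp (1 - x) * φ t x

/-- The zero-order coefficient of the conjugated operator. -/
def carlG (b a : ℝ) (l l1 : ℝ → ℝ) (t x : ℝ) : ℝ :=
  (l t * exp (1 - x)) ^ 2 - l t * exp (1 - x)
    + (b * l1 t * (exp 3 - exp (1 - x)) + b * (l t * exp (1 - x)) - a * b)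

/-- The density of the Carleman functional. -/
def carlU (b a : ℝ) (l l1 : ℝ → ℝ) (φ : ℝ → ℝ → ℝ) (t x : ℝ) : ℝ :=
  carlE (l t) x * (carlG b a l l1 t x * φ t x ^ 2 - carlZ l φ t x ^ 2) * (b / 2)

/-- The time derivative of `carlU`. -/
def carlUt (b a : ℝ) (l l1 l2 : ℝ → ℝ) (φ : ℝ → ℝ → ℝ) (t x : ℝ) : ℝ :=
  carlE (l t) x * (-(2 * (exp 3 - exp (1 - x)) * l1 t)
      * (carlG b a l l1 t x * φ t x ^ 2 - carlZ l φ t x ^ 2)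
    + (2 * (l t * l1 t * exp (1 - x) ^ 2) - l1 t * exp (1 - x)
        + (b * l2 t * (exp 3 - exp (1 - x)) + b * (l1 t * exp (1 - x)))) * φ t x ^ 2
    + 2 * carlG b a l l1 t x * φ t x * Dt φ t x
    - 2 * carlZ l φ t x
      * (Dt (Dx φ) t x - l1 t * exp (1 - x) * φ t x - l t * exp (1 - x) * Dt φ t x)) * (b / 2)

/-- The flux of the Carleman functional. -/
def carlFlux (b a : ℝ) (l l1 : ℝ → ℝ) (φ : ℝ → ℝ → ℝ) (t x : ℝ) : ℝ :=
  carlE (l t) x * (carlZ l φ t x * (b * Dt φ t x - b * l1 t * (exp 3 - exp (1 - x)) * φ t x)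
    + (l t * exp (1 - x) + b / 2) * carlZ l φ t x ^ 2
    + carlG b a l l1 t x * (l t * exp (1 - x) + b / 2) * φ t x ^ 2)

/-- The space derivative of `carlFlux`. -/
def carlFluxX (b a : ℝ) (l l1 : ℝ → ℝ) (φ : ℝ → ℝ → ℝ) (t x : ℝ) : ℝ :=
  carlE (l t) x * (-(2 * (l t * exp (1 - x)))
      * (carlZ l φ t x * (b * Dt φ t x - b * l1 t * (exp 3 - exp (1 - x)) * φ t x)
        + (l t * exp (1 - x) + b / 2) * carlZ l φ t x ^ 2
        + carlG b a l l1 t x * (l t * exp (1 - x) + b / 2) * φ t x ^ 2)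
    + (Dx (Dx φ) t x + l t * exp (1 - x) * φ t x - l t * exp (1 - x) * Dx φ t x)
      * (b * Dt φ t x - b * l1 t * (exp 3 - exp (1 - x)) * φ t x)
    + carlZ l φ t x * (b * Dt (Dx φ) t x - b * l1 t * exp (1 - x) * φ t x
        - b * l1 t * (exp 3 - exp (1 - x)) * Dx φ t x)
    - l t * exp (1 - x) * carlZ l φ t x ^ 2
    + 2 * (l t * exp (1 - x) + b / 2) * carlZ l φ t x
      * (Dx (Dx φ) t x + l t * exp (1 - x) * φ t x - l t * exp (1 - x) * Dx φ t x)
    + (-(2 * (l t * exp (1 - x)) ^ 2) + l t * exp (1 - x)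
        + (b * l1 t * exp (1 - x) - b * (l t * exp (1 - x))))
      * (l t * exp (1 - x) + b / 2) * φ t x ^ 2
    - carlG b a l l1 t x * (l t * exp (1 - x)) * φ t x ^ 2
    + 2 * carlG b a l l1 t x * (l t * exp (1 - x) + b / 2) * φ t x * Dx φ t x)

theorem hasDerivAt_exp_one_sub (x : ℝ) :
    HasDerivAt (fun y => exp (1 - y)) (-exp (1 - x)) x :=
  (((hasDerivAt_id x).const_sub 1).exp).of_eq (fun _ => rfl) (by simp)

section

variable {T ε a : ℝ} {l l1 l2 : ℝ → ℝ} {φ : ℝ → ℝ → ℝ}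

theorem TimeWeight.scaledBounds (h : TimeWeight T ε a l l1 l2) {t x : ℝ} (ht : t ∈ Ioo 0 T)
    (hx : x ∈ Icc (-1 : ℝ) 0) :
    ScaledBounds (l t) ε⁻¹ (ε⁻¹ * l1 t) (ε⁻¹ ^ 2 * l2 t) (a * ε⁻¹) (exp (1 - x))
      (exp 3 - exp (1 - x)) := by
  obtain ⟨k1, k2, k3, k4⟩ := exp_one_sub_bounds hx
  have hε := h.eps_pos
  refine ⟨h.one_le ht, inv_pos.2 hε, ?_, ?_, ?_, mul_nonneg h.a_nonneg (inv_pos.2 hε).le, ?_,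
    k1, k2, k3, k4⟩
  · have := h.large t ht
    rw [← div_eq_mul_inv, div_le_iff₀ hε]; linarith
  · have := h.bound1 t ht
    rw [abs_mul, abs_of_pos (inv_pos.2 hε)]
    field_simp
    linarith
  · have := h.bound2 t ht
    rw [abs_mul, abs_of_pos (pow_pos (inv_pos.2 hε) 2)]
    field_simp
    linarith
  · have := h.bounda t ht
    field_simp
    linarith

theorem hasDerivAt_carlU (h : TimeWeight T ε a l l1 l2) (hφ : Smooth2 φ) (b : ℝ) {t : ℝ}
    (ht : t ∈ Ioo 0 T) (x : ℝ) :
    HasDerivAt (fun s => carlU b a l l1 φ s x) (carlUt b a l l1 l2 φ t x) t := by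
  have hl := h.deriv1 t ht
  have hl1 := h.deriv2 t ht
  have hy := hφ.hasDerivAt_t t x
  have hyx := hφ.dx.hasDerivAt_t t x
  have hE : HasDerivAt (fun s => carlE (l s) x)
      (carlE (l t) x * -(2 * (exp 3 - exp (1 - x)) * l1 t)) t :=
    ((hl.const_mul (2 * (exp 3 - exp (1 - x)))).neg).exp.of_eq (fun _ => rfl) rfl
  have hG := ((((hl.mul_const (exp (1 - x))).pow 2).sub (hl.mul_const (exp (1 - x)))).add
    ((((hl1.const_mul b).mul_const (exp 3 - exp (1 - x))).add
      ((hl.mul_const (exp (1 - x))).const_mul b)).sub_const (a * b)))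
  have hZ := hyx.sub ((hl.mul_const (exp (1 - x))).mul hy)
  refine ((hE.mul ((hG.mul (hy.pow 2)).sub (hZ.pow 2))).mul_const (b / 2)).of_eq
    (fun _ => rfl) ?_
  simp only [carlUt, carlG, carlZ, Pi.add_apply, Pi.sub_apply, Pi.mul_apply, Pi.pow_apply]
  push_cast
  ring

theorem hasDerivAt_carlFlux (hφ : Smooth2 φ) (b : ℝ) (t x : ℝ) :
    HasDerivAt (fun y => carlFlux b a l l1 φ t y) (carlFluxX b a l l1 φ t x) x := by
  have hk := hasDerivAt_exp_one_sub x
  have hy := hφ.hasDerivAt_x t x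
  have hyx := hφ.dx.hasDerivAt_x t x
  have hyt := hφ.dt.hasDerivAt_x t x
  rw [hφ.Dx_Dt] at hyt
  have hd := hk.const_sub (exp 3)
  have hw := hk.const_mul (l t)
  have hE : HasDerivAt (fun y => carlE (l t) y)
      (carlE (l t) x * -(2 * - -exp (1 - x) * l t)) x :=
    (((hd.const_mul 2).mul_const (l t)).neg).exp.of_eq (fun _ => rfl) rfl
  have hG := ((hw.pow 2).sub hw).add
    (((hd.const_mul (b * l1 t)).add (hw.const_mul b)).sub_const (a * b))
  have hZ := hyx.sub (hw.mul hy)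
  have hQ := (hyt.const_mul b).sub ((hd.const_mul (b * l1 t)).mul hy)
  have hB := hw.add_const (b / 2)
  refine (hE.mul (((hZ.mul hQ).add (hB.mul (hZ.pow 2))).add ((hG.mul hB).mul (hy.pow 2)))).of_eq
    (fun _ => rfl) ?_
  simp only [carlFluxX, carlG, carlZ, Pi.add_apply, Pi.sub_apply, Pi.mul_apply, Pi.pow_apply]
  push_cast
  ring

theorem carlUt_le (h : TimeWeight T ε a l l1 l2) (hφ : AdjSys T ε a φ) {t x : ℝ}
    (ht : t ∈ Ioo 0 T) (hx : x ∈ Icc (-1 : ℝ) 0) :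
    carlUt ε⁻¹ a l l1 l2 φ t x
      ≤ -carlFluxX ε⁻¹ a l l1 φ t x
        - (l t * exp (1 - x)) ^ 3 * carlE (l t) x * φ t x ^ 2 := by
  have hb := (h.scaledBounds ht hx).bulk
  have hε := h.eps_pos
  have hp : Dx (Dx φ) t x + ε⁻¹ * Dt φ t x + ε⁻¹ * Dx φ t x - a * ε⁻¹ * φ t x = 0 := by
    have := hφ.pde t ht x hx
    field_simp
    linarith
  have hE : 0 < carlE (l t) x := exp_pos _
  have hw : 0 ≤ l t * exp (1 - x) := mul_nonneg (h.pos ht).le (exp_pos _).le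
  simp only [carlUt, carlFluxX, carlG]
  have hz : carlZ l φ t x = Dx φ t x - l t * exp (1 - x) * φ t x := rfl
  set z := carlZ l φ t x
  set b := ε⁻¹
  set k := exp (1 - x)
  set E := carlE (l t) x
  set P := b * Dt φ t x - b * l1 t * (exp 3 - k) * φ t x + (2 * (l t * k) + b) * z with hP
  have n1 : 0 ≤ E * (P ^ 2 + l t * k * z ^ 2) := by positivity
  have n2 := mul_le_mul_of_nonneg_right hb (mul_nonneg hE.le (sq_nonneg (φ t x)))
  rw [hP] at n1
  clear_value z b k E
  subst hz
  linear_combination n1 + n2 + E * P * hp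

end

/-- The Carleman functional. -/
def carlH (b a : ℝ) (l l1 : ℝ → ℝ) (φ : ℝ → ℝ → ℝ) (t : ℝ) : ℝ :=
  ∫ x in (-1 : ℝ)..0, carlU b a l l1 φ t x

/-- The weighted interior energy controlled by the Carleman functional. -/
def interiorTerm (l : ℝ → ℝ) (φ : ℝ → ℝ → ℝ) (t : ℝ) : ℝ :=
  ∫ x in (-1 : ℝ)..0, (l t * exp (1 - x)) ^ 3 * carlE (l t) x * φ t x ^ 2

/-- The weighted boundary density controlled by the Carleman functional. -/
def traceTerm (l : ℝ → ℝ) (φ : ℝ → ℝ → ℝ) (t x : ℝ) : ℝ :=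
  (l t * exp (1 - x)) ^ 3 * carlE (l t) x * φ t x ^ 2

section

variable {T ε a : ℝ} {l l1 l2 : ℝ → ℝ} {φ : ℝ → ℝ → ℝ}

theorem Smooth2.continuous_slice {u : ℝ → ℝ → ℝ} (hu : Smooth2 u) (t : ℝ) :
    Continuous (fun x => u t x) :=
  hu.continuous_comp continuous_const continuous_id

theorem TimeWeight.continuousOn (h : TimeWeight T ε a l l1 l2) : ContinuousOn l (Ioo 0 T) :=
  fun t ht => (h.deriv1 t ht).continuousAt.continuousWithinAt

theorem TimeWeight.continuousOn_deriv (h : TimeWeight T ε a l l1 l2) :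
    ContinuousOn l1 (Ioo 0 T) :=
  fun t ht => (h.deriv2 t ht).continuousAt.continuousWithinAt

theorem continuous_carlU (hφ : Smooth2 φ) (b t : ℝ) : Continuous (carlU b a l l1 φ t) := by
  have c := hφ.continuous_slice t
  have cx := hφ.dx.continuous_slice t
  unfold carlU carlE carlG carlZ
  fun_prop

theorem continuousOn_carlUt (h : TimeWeight T ε a l l1 l2) (hφ : Smooth2 φ) (b : ℝ) :
    ContinuousOn (fun p : ℝ × ℝ => carlUt b a l l1 l2 φ p.1 p.2) (Ioo 0 T ×ˢ univ) := by
  have hm : MapsTo (fun p : ℝ × ℝ => p.1) (Ioo 0 T ×ˢ (univ : Set ℝ)) (Ioo 0 T) :=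
    fun p hp => hp.1
  have k0 : ContinuousOn (fun p : ℝ × ℝ => l p.1) (Ioo 0 T ×ˢ univ) :=
    h.continuousOn.comp continuous_fst.continuousOn hm
  have k1 : ContinuousOn (fun p : ℝ × ℝ => l1 p.1) (Ioo 0 T ×ˢ univ) :=
    h.continuousOn_deriv.comp continuous_fst.continuousOn hm
  have k2 : ContinuousOn (fun p : ℝ × ℝ => l2 p.1) (Ioo 0 T ×ˢ univ) :=
    h.cont2.comp continuous_fst.continuousOn hm
  have c := hφ.continuous_uncurry.continuousOn (s := Ioo 0 T ×ˢ univ)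
  have cx := hφ.dx.continuous_uncurry.continuousOn (s := Ioo 0 T ×ˢ univ)
  have ct := hφ.dt.continuous_uncurry.continuousOn (s := Ioo 0 T ×ˢ univ)
  have ctx := hφ.dx.dt.continuous_uncurry.continuousOn (s := Ioo 0 T ×ˢ univ)
  unfold carlUt carlE carlG carlZ
  obtain ⟨L, hL⟩ : ∃ L : ℝ × ℝ → ℝ, ∀ p, l p.1 = L p := ⟨_, fun _ => rfl⟩
  obtain ⟨L1, hL1⟩ : ∃ L : ℝ × ℝ → ℝ, ∀ p, l1 p.1 = L p := ⟨_, fun _ => rfl⟩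
  obtain ⟨L2, hL2⟩ : ∃ L : ℝ × ℝ → ℝ, ∀ p, l2 p.1 = L p := ⟨_, fun _ => rfl⟩
  obtain ⟨P, hP⟩ : ∃ L : ℝ × ℝ → ℝ, ∀ p, φ p.1 p.2 = L p := ⟨_, fun _ => rfl⟩
  obtain ⟨X, hX⟩ : ∃ L : ℝ × ℝ → ℝ, ∀ p, Dx φ p.1 p.2 = L p := ⟨_, fun _ => rfl⟩
  obtain ⟨Y, hY⟩ : ∃ L : ℝ × ℝ → ℝ, ∀ p, Dt φ p.1 p.2 = L p := ⟨_, fun _ => rfl⟩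
  obtain ⟨Z, hZ⟩ : ∃ L : ℝ × ℝ → ℝ, ∀ p, Dt (Dx φ) p.1 p.2 = L p := ⟨_, fun _ => rfl⟩
  simp only [hL, hL1, hL2, hP, hX, hY, hZ] at k0 k1 k2 c cx ct ctx ⊢
  fun_prop

theorem continuous_carlFluxX (hφ : Smooth2 φ) (b t : ℝ) :
    Continuous (carlFluxX b a l l1 φ t) := by
  have c := hφ.continuous_slice t
  have cx := hφ.dx.continuous_slice t
  have cxx := hφ.dx.dx.continuous_slice t
  have ct := hφ.dt.continuous_slice t
  have ctx := hφ.dx.dt.continuous_slice t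
  unfold carlFluxX carlE carlG carlZ
  fun_prop

theorem continuous_traceTerm (hφ : Smooth2 φ) (t : ℝ) : Continuous (traceTerm l φ t) := by
  have c := hφ.continuous_slice t
  unfold traceTerm carlE
  fun_prop

theorem carlFlux_right_ge (h : TimeWeight T ε a l l1 l2) (hφ : AdjSys T ε a φ) {t : ℝ}
    (ht : t ∈ Ioo 0 T) : traceTerm l φ t 0 / 2 ≤ carlFlux ε⁻¹ a l l1 φ t 0 := by
  have hε := h.eps_pos
  have hb := (h.scaledBounds ht (x := 0) (by norm_num)).flux_right (φ t 0) (carlZ l φ t 0)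
  have hr : Dt φ t 0 = carlZ l φ t 0 + l t * exp (1 - 0) * φ t 0 + ε⁻¹ * φ t 0 := by
    have := hφ.right t ht
    unfold carlZ
    field_simp
    linarith
  have hE : 0 < carlE (l t) 0 := exp_pos _
  have := mul_le_mul_of_nonneg_left hb hE.le
  unfold traceTerm carlFlux carlG
  rw [hr]
  linear_combination this

theorem carlFlux_left_le (h : TimeWeight T ε a l l1 l2) (hφ : AdjSys T ε a φ) {t : ℝ}
    (ht : t ∈ Ioo 0 T) :
    carlFlux ε⁻¹ a l l1 φ t (-1)
      ≤ 2500 * carlE (l t) (-1) * (l t * Dt φ t (-1) ^ 2 + l t ^ 3 * φ t (-1) ^ 2) := by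
  have hb := (h.scaledBounds ht (x := -1) (by norm_num)).flux_left (φ t (-1)) (Dt φ t (-1))
    (carlZ l φ t (-1)) (by
      have := hφ.left t ht
      unfold carlZ
      linear_combination this)
  have hE : 0 < carlE (l t) (-1) := exp_pos _
  have := mul_le_mul_of_nonneg_left hb hE.le
  unfold carlFlux carlG
  linear_combination this

theorem AdjSys.exists_deriv_carlH (h : TimeWeight T ε a l l1 l2) (hφ : AdjSys T ε a φ) {t : ℝ}
    (ht : t ∈ Ioo 0 T) :
    ∃ D, HasDerivAt (carlH ε⁻¹ a l l1 φ) D t ∧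
      D ≤ -interiorTerm l φ t - traceTerm l φ t 0 / 2
        + 2500 * carlE (l t) (-1) * (l t * Dt φ t (-1) ^ 2 + l t ^ 3 * φ t (-1) ^ 2) := by
  refine ⟨_, hasDerivAt_integral_slab (fun s _ => continuous_carlU hφ.smooth ε⁻¹ s)
    (fun s hs x => hasDerivAt_carlU h hφ.smooth ε⁻¹ hs x)
    (continuousOn_carlUt h hφ.smooth ε⁻¹) ht, ?_⟩
  have hUt : Continuous (carlUt ε⁻¹ a l l1 l2 φ t) := by
    have := (continuousOn_carlUt h hφ.smooth ε⁻¹).comp_continuous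
      (f := fun x : ℝ => (t, x)) (by fun_prop) (fun x => ⟨ht, mem_univ _⟩)
    exact this
  have hX := continuous_carlFluxX (a := a) (l := l) (l1 := l1) hφ.smooth ε⁻¹ t
  have hI := continuous_traceTerm (l := l) hφ.smooth t
  have hF : (∫ x in (-1 : ℝ)..0, carlFluxX ε⁻¹ a l l1 φ t x)
      = carlFlux ε⁻¹ a l l1 φ t 0 - carlFlux ε⁻¹ a l l1 φ t (-1) :=
    integral_eq_sub_of_hasDerivAt (fun x _ => hasDerivAt_carlFlux hφ.smooth ε⁻¹ t x)
      (hX.intervalIntegrable _ _)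
  have hle : (∫ x in (-1 : ℝ)..0, carlUt ε⁻¹ a l l1 l2 φ t x)
      ≤ ∫ x in (-1 : ℝ)..0, (-carlFluxX ε⁻¹ a l l1 φ t x - traceTerm l φ t x) :=
    integral_mono_on (by norm_num) (hUt.intervalIntegrable _ _)
      ((hX.fun_neg.sub hI).intervalIntegrable _ _) fun x hx => carlUt_le h hφ ht hx
  rw [integral_sub (f := fun x => -carlFluxX ε⁻¹ a l l1 φ t x)
      (hX.fun_neg.intervalIntegrable _ _) (hI.intervalIntegrable _ _),
    intervalIntegral.integral_neg, hF] at hle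
  have h0 := carlFlux_right_ge h hφ ht
  have h1 := carlFlux_left_le h hφ ht
  have : interiorTerm l φ t = ∫ x in (-1 : ℝ)..0, traceTerm l φ t x := rfl
  linarith

end

/-- The left-hand side of the Carleman estimate at a fixed time. -/
def carlL (l : ℝ → ℝ) (φ : ℝ → ℝ → ℝ) (t : ℝ) : ℝ :=
  interiorTerm l φ t + traceTerm l φ t 0 + traceTerm l φ t (-1)

/-- The observation at `x = -1`. -/
def obsTerm (l : ℝ → ℝ) (φ : ℝ → ℝ → ℝ) (t : ℝ) : ℝ :=
  l t ^ 7 * (carlE (l t) (-1) ^ 2 / carlE (l t) 0) * φ t (-1) ^ 2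

/-- The Carleman functional, corrected by weighted energies and by a boundary product. -/
def carlLyap (ε a : ℝ) (l l1 : ℝ → ℝ) (φ : ℝ → ℝ → ℝ) (t : ℝ) : ℝ :=
  carlH ε⁻¹ a l l1 φ t
    - ε⁻¹ / 8 * (energyY ε a l (exp 3 - exp (1 - 0)) (-5) (Dt φ) t
      + 2 * ε ^ 2 * energyY ε a l (exp 3 - exp (1 - 0)) (-1) φ t)
    - 6000 * (expWeight (exp 3 - exp (1 - (-1))) 1 (l t) * (φ t (-1) * Dt φ t (-1)))

section

variable {T ε a : ℝ} {l l1 l2 : ℝ → ℝ} {φ : ℝ → ℝ → ℝ}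

theorem carlE_pos (y x : ℝ) : 0 < carlE y x := exp_pos _

theorem carlE_zero_le {y x : ℝ} (hy : 0 ≤ y) (hx : x ≤ 0) : carlE y 0 ≤ carlE y x := by
  refine exp_le_exp.2 ?_
  have : exp (1 - 0) ≤ exp (1 - x) := exp_le_exp.2 (by linarith)
  nlinarith

theorem traceTerm_ge (φ : ℝ → ℝ → ℝ) {t x : ℝ} (hl : 0 ≤ l t) (hx : x ∈ Icc (-1 : ℝ) 0) :
    l t ^ 3 * carlE (l t) 0 * φ t x ^ 2 ≤ traceTerm l φ t x := by
  have hk : 1 ≤ exp (1 - x) := one_le_exp (by linarith [hx.2])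
  have hE := carlE_zero_le hl hx.2
  have := (carlE_pos (l t) 0).le
  have h1 : l t ≤ l t * exp (1 - x) := le_mul_of_one_le_right hl hk
  unfold traceTerm
  gcongr

theorem mul_X1normSq_le_carlL (h : TimeWeight T ε a l l1 l2) (hφ : Smooth2 φ) {t : ℝ}
    (ht : t ∈ Ioo 0 T) :
    expWeight (exp 3 - exp (1 - 0)) 3 (l t) * X1normSq ε (φ t) ≤ carlL l φ t := by
  have hl := (h.pos ht).le
  have hε := h.eps_pos
  have hε1 := h.eps_lt_one
  have h0 := traceTerm_ge φ hl (x := 0) (by norm_num)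
  have h1 := traceTerm_ge φ hl (x := -1) (by norm_num)
  have hw : expWeight (exp 3 - exp (1 - 0)) 3 (l t) = l t ^ 3 * carlE (l t) 0 := by
    unfold expWeight carlE
    norm_cast
  have hw0 : 0 ≤ l t ^ 3 * carlE (l t) 0 := mul_nonneg (by positivity) (carlE_pos _ _).le
  have hI : l t ^ 3 * carlE (l t) 0 * (∫ x in (-1 : ℝ)..0, φ t x ^ 2) ≤ interiorTerm l φ t := by
    rw [← intervalIntegral.integral_const_mul]
    refine integral_mono_on (by norm_num)
      (Continuous.intervalIntegrable ?_ _ _) ((continuous_traceTerm hφ t).intervalIntegrable _ _)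
      fun x hx => traceTerm_ge φ hl hx
    have := hφ.continuous_slice t
    fun_prop
  rw [hw, X1normSq, carlL]
  set w := l t ^ 3 * carlE (l t) 0
  have e0 : ε * (w * φ t 0 ^ 2) ≤ w * φ t 0 ^ 2 :=
    mul_le_of_le_one_left (by positivity) hε1.le
  have e1 : ε * (w * φ t (-1) ^ 2) ≤ w * φ t (-1) ^ 2 :=
    mul_le_of_le_one_left (by positivity) hε1.le
  linarith

theorem AdjSys.exists_deriv_energy (h : TimeWeight T ε a l l1 l2) (hφ : AdjSys T ε a φ) {t : ℝ}
    (ht : t ∈ Ioo 0 T) :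
    ∃ D, HasDerivAt (fun s => ε⁻¹ / 8 * (energyY ε a l (exp 3 - exp (1 - 0)) (-5) (Dt φ) s
        + 2 * ε ^ 2 * energyY ε a l (exp 3 - exp (1 - 0)) (-1) φ s)) D t ∧
      expWeight (exp 3 - exp (1 - 0)) (-5) (l t) * Dt (Dt φ) t (-1) ^ 2 / 16 - carlL l φ t / 4
        ≤ D := by
  obtain ⟨-, -, c0, c1⟩ := exp_one_sub_bounds (x := 0) (by norm_num)
  have hε := h.eps_pos
  have hε1 := h.eps_lt_one
  have c1' : exp 3 - exp (1 - 0) ≤ 20 := by linarith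
  obtain ⟨D1, hD1, h1⟩ := hφ.dt.exists_deriv_energyY h c0 c1' (m := -5)
    (by norm_num) (by norm_num) ht
  obtain ⟨D2, hD2, h2⟩ := hφ.exists_deriv_energyY h c0 c1' (m := -1)
    (by norm_num) (by norm_num) ht
  refine ⟨_, (hD1.add (hD2.const_mul (2 * ε ^ 2))).const_mul (ε⁻¹ / 8), ?_⟩
  have h3 := mul_X1normSq_le_carlL h hφ.smooth ht
  norm_num only at h1 h2 h3 ⊢
  have hρ := (expWeight_pos (c := exp 3 - exp 1) (m := -5) (h.pos ht)).le
  have hρ3 := (expWeight_pos (c := exp 3 - exp 1) (m := 3) (h.pos ht)).le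
  have hX : ε * Dt (Dt φ) t (-1) ^ 2 ≤ X1normSq ε (Dt (Dt φ) t) := by
    have : 0 ≤ ∫ x in (-1 : ℝ)..0, Dt (Dt φ) t x ^ 2 :=
      intervalIntegral.integral_nonneg (by norm_num) fun x _ => sq_nonneg _
    unfold X1normSq
    nlinarith [mul_nonneg hε.le (sq_nonneg (Dt (Dt φ) t 0))]
  have hX' := mul_le_mul_of_nonneg_left hX hρ
  have hL : 0 ≤ carlL l φ t := (mul_nonneg hρ3 (X1normSq_nonneg hε.le _)).trans h3
  have h2' := mul_le_mul_of_nonneg_left h2 (by positivity : 0 ≤ 2 * ε ^ 2)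
  have h3' := mul_le_mul_of_nonneg_left h3 (by positivity : 0 ≤ 2 * ε ^ 4)
  have hε3 : ε ^ 4 ≤ ε := by
    calc ε ^ 4 ≤ ε ^ 1 := pow_le_pow_of_le_one hε.le hε1.le (by norm_num)
      _ = ε := pow_one ε
  have h4 := mul_le_mul_of_nonneg_right hε3 hL
  have key : ε * (expWeight (exp 3 - exp 1) (-5) (l t) * Dt (Dt φ) t (-1) ^ 2 / 16
      - carlL l φ t / 4) ≤ (D1 + 2 * ε ^ 2 * D2) / 8 := by
    linarith
  calc _ ≤ ε⁻¹ * ((D1 + 2 * ε ^ 2 * D2) / 8) := by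
        rw [← div_eq_inv_mul, le_div_iff₀ hε]; linarith
    _ = _ := by ring

/-- Weighted Young inequality for the boundary product. -/
theorem young_boundary {E0 E1 L ρ S D y y1 y2 : ℝ} (hE0 : 0 < E0) (hE : E0 ≤ E1) (hL : 1 ≤ L)
    (hρ : L ^ 5 * ρ = E0) (hS : S = L * E1) (hD : |D| ≤ L ^ 2 * S) :
    3000 * E1 * (L * y1 ^ 2 + L ^ 3 * y ^ 2) - 6000 * (D * (y * y1) + S * (y1 * y1 + y * y2))
      ≤ ρ * y2 ^ 2 / 16 + 150000000 * (L ^ 7 * (E1 ^ 2 / E0) * y ^ 2) := by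
  subst hS
  have hL0 : 0 < L := by linarith
  have hE1 : 0 < E1 := by linarith
  have hρ0 : ρ = E0 / L ^ 5 := by field_simp; linarith
  have hEE : E1 ≤ E1 ^ 2 / E0 := by rw [le_div_iff₀ hE0]; nlinarith
  have a1 : L ^ 3 * E1 * y ^ 2 ≤ L ^ 7 * (E1 ^ 2 / E0) * y ^ 2 := by
    have : L ^ 3 ≤ L ^ 7 := pow_le_pow_right₀ hL (by norm_num)
    gcongr
  have a2 : L ^ 5 * E1 * y ^ 2 ≤ L ^ 7 * (E1 ^ 2 / E0) * y ^ 2 := by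
    have : L ^ 5 ≤ L ^ 7 := pow_le_pow_right₀ hL (by norm_num)
    gcongr
  have a3 : -(2 * (D * (y * y1))) ≤ L * E1 * y1 ^ 2 + L ^ 5 * E1 * y ^ 2 := by
    have h1 : -(D * (y * y1)) ≤ L ^ 2 * (L * E1) * |y * y1| := by
      refine (neg_le_abs _).trans ?_
      rw [abs_mul]
      gcongr
    have h2 : 2 * (L ^ 2 * |y * y1|) ≤ y1 ^ 2 + L ^ 4 * y ^ 2 := by
      rw [abs_mul, ← sq_abs y, ← sq_abs y1]
      nlinarith [sq_nonneg (|y1| - L ^ 2 * |y|)]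
    nlinarith [mul_le_mul_of_nonneg_left h2 (by positivity : 0 ≤ L * E1)]
  have a4 : -(6000 * (L * E1 * (y * y2)))
      ≤ ρ * y2 ^ 2 / 16 + 144000000 * (L ^ 7 * (E1 ^ 2 / E0) * y ^ 2) := by
    have : 0 ≤ E0 / L ^ 5 / 16 * (y2 + 48000 * (L ^ 6 * E1 / E0 * y)) ^ 2 := by positivity
    rw [hρ0]
    have e : E0 / L ^ 5 / 16 * (y2 + 48000 * (L ^ 6 * E1 / E0 * y)) ^ 2
        = E0 / L ^ 5 * y2 ^ 2 / 16 + 6000 * (L * E1 * (y * y2))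
          + 144000000 * (L ^ 7 * (E1 ^ 2 / E0) * y ^ 2) := by
      field_simp
      ring
    linarith
  have a5 : 0 ≤ L ^ 7 * (E1 ^ 2 / E0) * y ^ 2 := by positivity
  linarith

theorem AdjSys.exists_deriv_carlLyap (h : TimeWeight T ε a l l1 l2) (hφ : AdjSys T ε a φ) {t : ℝ}
    (ht : t ∈ Ioo 0 T) :
    ∃ D, HasDerivAt (carlLyap ε a l l1 φ) D t ∧
      D ≤ -(carlL l φ t / 4) + 150000000 * obsTerm l φ t := by
  obtain ⟨-, k8, c0, c1⟩ := exp_one_sub_bounds (x := -1) (by norm_num)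
  have hl := h.one_le ht
  have hε1 := h.eps_lt_one
  obtain ⟨D1, hD1, h1⟩ := hφ.exists_deriv_carlH h ht
  obtain ⟨D2, hD2, h2⟩ := hφ.exists_deriv_energy h ht
  obtain ⟨D3, hD3, h3⟩ := h.hasDerivAt_expWeight c0 (c1.trans (by norm_num)) (m := 1)
    (by norm_num) ht
  refine ⟨_, (hD1.sub hD2).sub ((hD3.mul ((hφ.smooth.hasDerivAt_t t (-1)).mul
    (hφ.smooth.dt.hasDerivAt_t t (-1)))).const_mul 6000), ?_⟩
  have hS : expWeight (exp 3 - exp (1 - (-1))) 1 (l t) = l t * carlE (l t) (-1) := by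
    simp only [expWeight, carlE, zpow_one]
  have hρ : l t ^ 5 * expWeight (exp 3 - exp (1 - 0)) (-5) (l t) = carlE (l t) 0 := by
    have : l t ≠ 0 := by linarith
    simp only [expWeight, carlE]
    rw [zpow_neg]
    norm_cast
    field_simp
  have hD3' : |D3| ≤ l t ^ 2 * expWeight (exp 3 - exp (1 - (-1))) 1 (l t) := by
    refine h3.trans ?_
    have := (expWeight_pos (c := exp 3 - exp (1 - (-1))) (m := 1) (h.pos ht)).le
    gcongr
    nlinarith [sq_nonneg (l t)]
  have hY := young_boundary (y := φ t (-1)) (y1 := Dt φ t (-1)) (y2 := Dt (Dt φ) t (-1))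
    (carlE_pos (l t) 0) (carlE_zero_le (x := -1) (by linarith) (by norm_num))
    (by linarith : 1 ≤ l t) hρ hS hD3'
  have hI : 0 ≤ interiorTerm l φ t := by
    refine intervalIntegral.integral_nonneg (by norm_num) fun x _ => ?_
    have := carlE_pos (l t) x
    have := h.pos ht
    positivity
  have hT : traceTerm l φ t (-1) ≤ 512 * (l t ^ 3 * carlE (l t) (-1) * φ t (-1) ^ 2) := by
    have := carlE_pos (l t) (-1)
    have hk : exp (1 - (-1)) ^ 3 ≤ 8 ^ 3 := by gcongr
    have := mul_le_mul_of_nonneg_left hk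
      (by positivity : 0 ≤ l t ^ 3 * carlE (l t) (-1) * φ t (-1) ^ 2)
    unfold traceTerm
    linarith
  have p1 : 0 ≤ carlE (l t) (-1) * (l t * Dt φ t (-1) ^ 2) := by
    have := carlE_pos (l t) (-1); positivity
  have p2 : 0 ≤ l t ^ 3 * carlE (l t) (-1) * φ t (-1) ^ 2 := by
    have := carlE_pos (l t) (-1); positivity
  unfold obsTerm
  have hLdef : carlL l φ t = interiorTerm l φ t + traceTerm l φ t 0 + traceTerm l φ t (-1) := rfl
  simp only [Pi.mul_apply]
  linarith

end

/-- Boundedness of a function of time on `(0, T)`. -/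
def BddOnTime (T : ℝ) (F : ℝ → ℝ) : Prop := ∃ K, ∀ t ∈ Ioo 0 T, |F t| ≤ K

namespace BddOnTime

variable {T : ℝ} {F G : ℝ → ℝ}

theorem const (c : ℝ) : BddOnTime T (fun _ => c) := ⟨|c|, fun _ _ => le_rfl⟩

theorem add (hF : BddOnTime T F) (hG : BddOnTime T G) : BddOnTime T (fun t => F t + G t) := by
  obtain ⟨K, hK⟩ := hF
  obtain ⟨M, hM⟩ := hG
  exact ⟨K + M, fun t ht => (abs_add_le _ _).trans (add_le_add (hK t ht) (hM t ht))⟩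

theorem mul (hF : BddOnTime T F) (hG : BddOnTime T G) : BddOnTime T (fun t => F t * G t) := by
  obtain ⟨K, hK⟩ := hF
  obtain ⟨M, hM⟩ := hG
  exact ⟨K * M, fun t ht => abs_mul_le_mul (hK t ht) (hM t ht)⟩

theorem const_mul (hF : BddOnTime T F) (c : ℝ) : BddOnTime T (fun t => c * F t) :=
  (const c).mul hF

theorem sub (hF : BddOnTime T F) (hG : BddOnTime T G) : BddOnTime T (fun t => F t - G t) := by
  obtain ⟨K, hK⟩ := hF
  obtain ⟨M, hM⟩ := hG
  exact ⟨K + M, fun t ht => (abs_sub _ _).trans (add_le_add (hK t ht) (hM t ht))⟩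

theorem congr (hF : BddOnTime T F) (h : ∀ t ∈ Ioo 0 T, G t = F t) : BddOnTime T G := by
  obtain ⟨K, hK⟩ := hF
  exact ⟨K, fun t ht => h t ht ▸ hK t ht⟩

theorem integral {u : ℝ → ℝ → ℝ}
    (h : ∃ K, ∀ t ∈ Ioo 0 T, ∀ x ∈ Icc (-1 : ℝ) 0, |u t x| ≤ K) :
    BddOnTime T (fun t => ∫ x in (-1 : ℝ)..0, u t x) := by
  obtain ⟨K, hK⟩ := h
  refine ⟨K, fun t ht => ?_⟩
  have := intervalIntegral.norm_integral_le_of_norm_le_const (a := -1) (b := 0) (f := u t) (C := K)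
    fun x hx => hK t ht x (by
      rw [uIoc_of_le (by norm_num)] at hx
      exact Ioc_subset_Icc_self hx)
  simpa using this

theorem integrableOn (hF : BddOnTime T F) (hc : ContinuousOn F (Ioo 0 T)) :
    IntegrableOn F (Icc 0 T) := by
  obtain ⟨K, hK⟩ := hF
  rw [integrableOn_Icc_iff_integrableOn_Ioo]
  exact Integrable.of_bound (hc.aestronglyMeasurable measurableSet_Ioo) K
    ((ae_restrict_iff' measurableSet_Ioo).2 (Filter.Eventually.of_forall hK))

end BddOnTime

theorem Smooth2.bddOnTime {u : ℝ → ℝ → ℝ} (hu : Smooth2 u) (T : ℝ) {x : ℝ}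
    (hx : x ∈ Icc (-1 : ℝ) 0) : BddOnTime T (fun t => u t x) := by
  obtain ⟨K, -, hK⟩ := hu.exists_bound T
  exact ⟨K, fun t ht => hK t (Ioo_subset_Icc_self ht) x hx⟩

theorem Smooth2.bddOnTime_integral_mul {u : ℝ → ℝ → ℝ} (hu : Smooth2 u) (T : ℝ) :
    BddOnTime T (fun t => ∫ x in (-1 : ℝ)..0, u t x * u t x) := by
  obtain ⟨K, -, hK⟩ := hu.exists_bound T
  exact .integral ⟨K * K, fun t ht x hx => abs_mul_le_mul (hK t (Ioo_subset_Icc_self ht) x hx)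
    (hK t (Ioo_subset_Icc_self ht) x hx)⟩

theorem Smooth2.bddOnTime_X1normSq {u : ℝ → ℝ → ℝ} (hu : Smooth2 u) (T ε : ℝ) :
    BddOnTime T (fun t => X1normSq ε (u t)) := by
  have h0 := hu.bddOnTime T (x := 0) (by norm_num)
  have h1 := hu.bddOnTime T (x := -1) (by norm_num)
  refine ((hu.bddOnTime_integral_mul T).add (((h0.mul h0).add (h1.mul h1)).const_mul ε)).congr
    fun t _ => ?_
  simp only [X1normSq, sq]

theorem Smooth2.bddOnTime_gradEnergy {u : ℝ → ℝ → ℝ} (hu : Smooth2 u) (T ε a : ℝ) :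
    BddOnTime T (gradEnergy ε a u) := by
  have h0 := hu.bddOnTime T (x := 0) (by norm_num)
  refine (((((hu.dx.bddOnTime_integral_mul T).const_mul ε).add
    ((hu.bddOnTime_integral_mul T).const_mul a)).add (h0.mul h0)).const_mul 2⁻¹).congr
    fun t _ => ?_
  simp only [gradEnergy]
  ring

/-- Exponential decay of a function of time as `l` tends to infinity. -/
def DecaysWith (T : ℝ) (l F : ℝ → ℝ) : Prop :=
  BddOnTime T (fun t => F t * (exp (l t) / l t ^ 5))

theorem one_le_exp_three_sub {x : ℝ} (hx : x ∈ Icc (-1 : ℝ) 0) : 1 ≤ exp 3 - exp (1 - x) := by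
  have h1 := Real.exp_one_gt_d9
  have e2 : exp 2 = exp 1 ^ 2 := by rw [← Real.exp_nat_mul]; norm_num
  have e3 : exp 3 = exp 1 ^ 3 := by rw [← Real.exp_nat_mul]; norm_num
  have h3 : exp (1 - x) ≤ exp 2 := exp_le_exp.2 (by linarith [hx.1])
  nlinarith [sq_nonneg (exp 1 - 2)]

theorem one_le_four_mul_sub :
    1 ≤ 4 * (exp 3 - exp (1 - (-1))) - 2 * (exp 3 - exp (1 - 0)) := by
  have h1 := Real.exp_one_gt_d9
  have e2 : exp (1 - (-1)) = exp 1 ^ 2 := by rw [← Real.exp_nat_mul]; norm_num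
  have e3 : exp 3 = exp 1 ^ 3 := by rw [← Real.exp_nat_mul]; norm_num
  rw [e2, e3, sub_zero]
  nlinarith [sq_nonneg (exp 1 - 2), mul_pos (exp_pos 1) (exp_pos 1)]

theorem expWeight_le {c : ℝ} (hc : 1 ≤ c) {m : ℤ} (hm : m ≤ 5) {y : ℝ} (hy : 1 ≤ y) :
    expWeight c m y ≤ y ^ 5 * exp (-y) := by
  have h5 : y ^ m ≤ y ^ 5 := mod_cast zpow_le_zpow_right₀ hy hm
  have : exp (-(2 * c * y)) ≤ exp (-y) := exp_le_exp.2 (by nlinarith)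
  unfold expWeight
  gcongr

section

variable {T ε a : ℝ} {l l1 l2 : ℝ → ℝ} {φ : ℝ → ℝ → ℝ}

theorem DecaysWith.expWeight_mul (h : TimeWeight T ε a l l1 l2) {c : ℝ} (hc : 1 ≤ c) {m : ℤ}
    (hm : m ≤ 5) {F : ℝ → ℝ} (hF : BddOnTime T F) :
    DecaysWith T l (fun t => expWeight c m (l t) * F t) := by
  have h1 : BddOnTime T (fun t => expWeight c m (l t) * (exp (l t) / l t ^ 5)) := by
    refine ⟨1, fun t ht => ?_⟩
    have hl := h.pos ht
    have hw := expWeight_le hc hm (by linarith [h.one_le ht] : 1 ≤ l t)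
    have hw0 := expWeight_pos (c := c) (m := m) hl
    simp only
    rw [abs_of_pos (by positivity), mul_div_assoc', div_le_one (by positivity)]
    calc _ ≤ l t ^ 5 * exp (-l t) * exp (l t) := by gcongr
      _ = l t ^ 5 := by rw [mul_assoc, ← exp_add]; simp
  exact (h1.mul hF).congr fun t _ => by ring

theorem DecaysWith.tendsto {F : ℝ → ℝ} (hF : DecaysWith T l F) (hl : ∀ t ∈ Ioo 0 T, 0 < l t)
    {f : Filter ℝ} (hf : ∀ᶠ t in f, t ∈ Ioo 0 T) (h : Filter.Tendsto l f Filter.atTop) :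
    Filter.Tendsto F f (𝓝 0) := by
  obtain ⟨K, hK⟩ := hF
  have h0 : Filter.Tendsto (fun t => K * (l t ^ 5 * exp (-l t))) f (𝓝 0) := by
    simpa using ((tendsto_pow_mul_exp_neg_atTop_nhds_zero 5).comp h).const_mul K
  refine squeeze_zero_norm' ?_ h0
  filter_upwards [hf] with t ht
  have hlt := hl t ht
  have := hK t ht
  rw [abs_mul, abs_of_pos (div_pos (exp_pos (l t)) (pow_pos hlt 5)), mul_div_assoc',
    div_le_iff₀ (by positivity)] at this
  rw [Real.norm_eq_abs, exp_neg]
  field_simp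
  linarith

theorem decaysWith_energyY (h : TimeWeight T ε a l l1 l2) {c : ℝ} (hc : 1 ≤ c) {m : ℤ}
    (hm : m ≤ 3) (hφ : Smooth2 φ) : DecaysWith T l (energyY ε a l c m φ) := by
  have h1 := DecaysWith.expWeight_mul h hc (by linarith : m ≤ 5) (hφ.bddOnTime_gradEnergy T ε a)
  have h2 := DecaysWith.expWeight_mul h hc (by linarith : m + 2 ≤ 5)
    (hφ.bddOnTime_X1normSq T ε)
  exact (BddOnTime.add h1 (BddOnTime.const_mul h2 (ε / 2))).congr fun t _ => by
    simp only [energyY]; ring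

theorem decaysWith_carlH (h : TimeWeight T ε a l l1 l2) (hφ : Smooth2 φ) :
    DecaysWith T l (carlH ε⁻¹ a l l1 φ) := by
  obtain ⟨K, hK0, hK⟩ := hφ.exists_bound T
  obtain ⟨M, hM0, hM⟩ := hφ.dx.exists_bound T
  have hε := inv_pos.2 h.eps_pos
  have hb : BddOnTime T (fun t => ∫ x in (-1 : ℝ)..0,
      carlU ε⁻¹ a l l1 φ t x * (exp (l t) / l t ^ 5)) := by
    refine BddOnTime.integral ⟨1 * (65 * (K * K) + (M + 8 * K) * (M + 8 * K)) * (ε⁻¹ / 2),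
      fun t ht x hx => ?_⟩
    have hl := h.one_le ht
    have hl0 := h.pos ht
    obtain ⟨g0, g1⟩ := (h.scaledBounds ht hx).zero_order_bounds
    obtain ⟨k2, k8, -, -⟩ := exp_one_sub_bounds hx
    have hy := hK t (Ioo_subset_Icc_self ht) x hx
    have hyx := hM t (Ioo_subset_Icc_self ht) x hx
    have hG : |carlG ε⁻¹ a l l1 t x / l t ^ 2| ≤ 65 := by
      have e0 : 0 ≤ carlG ε⁻¹ a l l1 t x := le_trans (by positivity) g0
      rw [abs_of_nonneg (by positivity), div_le_iff₀ (by positivity)]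
      exact g1
    have hZ : |carlZ l φ t x / l t| ≤ M + 8 * K := by
      have e1 : |Dx φ t x / l t| ≤ M := by
        rw [abs_div, abs_of_pos hl0, div_le_iff₀ hl0]
        nlinarith
      have e2 : |exp (1 - x) * φ t x| ≤ 8 * K :=
        abs_mul_le_mul (by rwa [abs_of_pos (exp_pos _)]) hy
      have e3 : carlZ l φ t x / l t = Dx φ t x / l t - exp (1 - x) * φ t x := by
        unfold carlZ; field_simp
      rw [e3]
      exact (abs_sub _ _).trans (add_le_add e1 e2)
    have hE : |carlE (l t) x * (exp (l t) / l t ^ 3)| ≤ 1 := by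
      have hE0 := carlE_pos (l t) x
      rw [abs_of_pos (by positivity), mul_div_assoc', div_le_one (by positivity), carlE, ← exp_add]
      calc _ ≤ exp 0 := exp_le_exp.2 (by nlinarith [one_le_exp_three_sub hx])
        _ ≤ l t ^ 3 := by rw [exp_zero]; exact one_le_pow₀ (by linarith)
    have e : carlU ε⁻¹ a l l1 φ t x * (exp (l t) / l t ^ 5)
        = carlE (l t) x * (exp (l t) / l t ^ 3) * (carlG ε⁻¹ a l l1 t x / l t ^ 2
          * (φ t x * φ t x) - carlZ l φ t x / l t * (carlZ l φ t x / l t)) * (ε⁻¹ / 2) := by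
      unfold carlU; field_simp
    rw [e]
    refine abs_mul_le_mul (abs_mul_le_mul hE ?_) (abs_of_pos (by positivity)).le
    exact (abs_sub _ _).trans (add_le_add
      (abs_mul_le_mul hG (abs_mul_le_mul hy hy)) (abs_mul_le_mul hZ hZ))
  exact hb.congr fun t _ => (intervalIntegral.integral_mul_const _ _).symm

theorem decaysWith_carlLyap (h : TimeWeight T ε a l l1 l2) (hφ : Smooth2 φ) :
    DecaysWith T l (carlLyap ε a l l1 φ) := by
  have c0 := one_le_exp_three_sub (x := 0) (by norm_num)
  have c1 := one_le_exp_three_sub (x := -1) (by norm_num)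
  have h1 := decaysWith_carlH h hφ
  have h2 := decaysWith_energyY h c0 (by norm_num : (-5 : ℤ) ≤ 3) hφ.dt
  have h3 := decaysWith_energyY h c0 (by norm_num : (-1 : ℤ) ≤ 3) hφ
  have h4 := DecaysWith.expWeight_mul h c1 (by norm_num : (1 : ℤ) ≤ 5)
    ((hφ.bddOnTime T (x := -1) (by norm_num)).mul (hφ.dt.bddOnTime T (x := -1) (by norm_num)))
  exact ((BddOnTime.sub h1 ((BddOnTime.add h2 (BddOnTime.const_mul h3 (2 * ε ^ 2))).const_mul
    (ε⁻¹ / 8))).sub (BddOnTime.const_mul h4 6000)).congr fun t _ => by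
      simp only [carlLyap]; ring

theorem pow_mul_exp_neg_le (n : ℕ) {y : ℝ} (hy : 0 ≤ y) : y ^ n * exp (-y) ≤ n.factorial := by
  have h := pow_div_factorial_le_exp y hy n
  rw [div_le_iff₀ (by positivity)] at h
  rw [exp_neg, ← div_eq_mul_inv, div_le_iff₀ (exp_pos y)]
  linarith

theorem exists_bound_traceTerm (h : TimeWeight T ε a l l1 l2) (hφ : Smooth2 φ) :
    ∃ K, ∀ t ∈ Ioo 0 T, ∀ x ∈ Icc (-1 : ℝ) 0, |traceTerm l φ t x| ≤ K := by
  obtain ⟨K, hK0, hK⟩ := hφ.exists_bound T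
  refine ⟨8 ^ 3 * (Nat.factorial 3 : ℝ) * (K * K), fun t ht x hx => ?_⟩
  have hl0 := h.pos ht
  have hy := hK t (Ioo_subset_Icc_self ht) x hx
  obtain ⟨k2, k8, -, -⟩ := exp_one_sub_bounds hx
  have hE : carlE (l t) x ≤ exp (-l t) :=
    exp_le_exp.2 (by nlinarith [one_le_exp_three_sub hx])
  have hE0 := carlE_pos (l t) x
  have e : traceTerm l φ t x
      = exp (1 - x) ^ 3 * (l t ^ 3 * carlE (l t) x) * (φ t x * φ t x) := by
    unfold traceTerm; ring
  rw [e]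
  refine abs_mul_le_mul (abs_mul_le_mul ?_ ?_) (abs_mul_le_mul hy hy)
  · rw [abs_of_pos (by positivity)]
    exact pow_le_pow_left₀ (exp_pos _).le k8 3
  · rw [abs_of_pos (by positivity)]
    exact (mul_le_mul_of_nonneg_left hE (by positivity)).trans (pow_mul_exp_neg_le 3 hl0.le)

theorem bddOnTime_obsTerm (h : TimeWeight T ε a l l1 l2) (hφ : Smooth2 φ) :
    BddOnTime T (obsTerm l φ) := by
  have h1 := hφ.bddOnTime T (x := -1) (by norm_num)
  have h2 : BddOnTime T (fun t => l t ^ 7 * (carlE (l t) (-1) ^ 2 / carlE (l t) 0)) := by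
    refine ⟨Nat.factorial 7, fun t ht => ?_⟩
    have hl0 := h.pos ht
    have e : carlE (l t) (-1) ^ 2 / carlE (l t) 0 ≤ exp (-l t) := by
      unfold carlE
      rw [← exp_nat_mul, ← exp_sub]
      refine exp_le_exp.2 ?_
      push_cast
      nlinarith [one_le_four_mul_sub]
    have e0 := carlE_pos (l t) (-1)
    have e1 := carlE_pos (l t) 0
    rw [abs_of_pos (by positivity)]
    exact (mul_le_mul_of_nonneg_left e (by positivity)).trans (pow_mul_exp_neg_le 7 hl0.le)
  exact (h2.mul (h1.mul h1)).congr fun t _ => by simp only [obsTerm]; ring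

theorem continuousOn_traceTerm (h : TimeWeight T ε a l l1 l2) (hφ : Smooth2 φ) (x : ℝ) :
    ContinuousOn (fun t => traceTerm l φ t x) (Ioo 0 T) := by
  have hl := h.continuousOn
  have hc := (hφ.continuous_comp continuous_id (continuous_const (y := x))).continuousOn
    (s := Ioo 0 T)
  unfold traceTerm carlE
  fun_prop

theorem continuousOn_obsTerm (h : TimeWeight T ε a l l1 l2) (hφ : Smooth2 φ) :
    ContinuousOn (obsTerm l φ) (Ioo 0 T) := by
  have hl := h.continuousOn
  have hc := (hφ.continuous_comp continuous_id (continuous_const (y := (-1 : ℝ)))).continuousOn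
    (s := Ioo 0 T)
  have hE : ∀ t ∈ Ioo 0 T, carlE (l t) 0 ≠ 0 := fun t _ => (carlE_pos _ _).ne'
  unfold obsTerm carlE at *
  fun_prop (disch := assumption)

theorem continuousOn_interiorTerm (h : TimeWeight T ε a l l1 l2) (hφ : Smooth2 φ) :
    ContinuousOn (interiorTerm l φ) (Ioo 0 T) := by
  rw [continuousOn_iff_continuous_domRestrict]
  refine intervalIntegral.continuous_parametric_intervalIntegral_of_continuous'
    (f := fun (t : Ioo 0 T) x => traceTerm l φ t x) ?_ _ _
  have hl : Continuous fun p : Ioo 0 T × ℝ => l p.1 :=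
    (continuousOn_iff_continuous_domRestrict.1 h.continuousOn).comp continuous_fst
  have hc : Continuous fun p : Ioo 0 T × ℝ => φ p.1 p.2 :=
    hφ.continuous_comp (continuous_subtype_val.comp continuous_fst) continuous_snd
  unfold traceTerm carlE Function.uncurry
  obtain ⟨L, hL⟩ : ∃ L : Ioo 0 T × ℝ → ℝ, ∀ p, l p.1 = L p := ⟨_, fun _ => rfl⟩
  obtain ⟨P, hP⟩ : ∃ L : Ioo 0 T × ℝ → ℝ, ∀ p, φ p.1 p.2 = L p := ⟨_, fun _ => rfl⟩
  simp only [hL, hP] at hl hc ⊢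
  fun_prop

/-- The Carleman estimate with observation at `x = -1` for a general time weight. -/
theorem AdjSys.carleman (hT : 0 < T) (h : TimeWeight T ε a l l1 l2) (hφ : AdjSys T ε a φ) :
    (∫ t in (0 : ℝ)..T, interiorTerm l φ t)
      + (∫ t in (0 : ℝ)..T, (traceTerm l φ t 0 + traceTerm l φ t (-1)))
      ≤ 600000000 * ∫ t in (0 : ℝ)..T, obsTerm l φ t := by
  have hs := hφ.smooth
  obtain ⟨K, hK⟩ := exists_bound_traceTerm h hs
  have i1 := (BddOnTime.integral ⟨K, hK⟩).integrableOn (continuousOn_interiorTerm h hs)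
  have i2 := (BddOnTime.integrableOn ⟨K, fun t ht => hK t ht 0 (by norm_num)⟩
    (continuousOn_traceTerm h hs 0)).add
    (BddOnTime.integrableOn ⟨K, fun t ht => hK t ht (-1) (by norm_num)⟩
    (continuousOn_traceTerm h hs (-1)))
  have i3 := (bddOnTime_obsTerm h hs).integrableOn (continuousOn_obsTerm h hs)
  choose! D hD hle using fun t (ht : t ∈ Ioo 0 T) => hφ.exists_deriv_carlLyap h ht
  have hd := decaysWith_carlLyap h hs
  have key := integral_nonneg_of_deriv_le hT hD
    (hd.tendsto (fun t ht => h.pos ht) (Ioo_mem_nhdsGT hT) h.tendsto_left)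
    (hd.tendsto (fun t ht => h.pos ht) (Ioo_mem_nhdsLT hT) h.tendsto_right)
    (r := fun t => 150000000 * obsTerm l φ t
      - 1 / 4 * (interiorTerm l φ t + (traceTerm l φ t 0 + traceTerm l φ t (-1))))
    ((i3.const_mul _).sub ((i1.add i2).const_mul _))
    fun t ht => (hle t ht).trans_eq (by unfold carlL; ring)
  have j1 : IntervalIntegrable (interiorTerm l φ) volume 0 T :=
    (intervalIntegrable_iff_integrableOn_Icc_of_le hT.le).2 i1
  have j2 : IntervalIntegrable (fun t => traceTerm l φ t 0 + traceTerm l φ t (-1)) volume 0 T :=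
    (intervalIntegrable_iff_integrableOn_Icc_of_le hT.le).2 i2
  have j3 : IntervalIntegrable (obsTerm l φ) volume 0 T :=
    (intervalIntegrable_iff_integrableOn_Icc_of_le hT.le).2 i3
  rw [intervalIntegral.integral_sub (j3.const_mul _) ((j1.add j2).const_mul _),
    intervalIntegral.integral_const_mul, intervalIntegral.integral_const_mul,
    intervalIntegral.integral_add j1 j2] at key
  linarith

end

section

variable {T ε a s : ℝ}

theorem hasDerivAt_parabola (T t : ℝ) :
    HasDerivAt (fun t => t * (T - t)) (T - 2 * t) t :=
  ((hasDerivAt_id t).mul ((hasDerivAt_id t).const_sub T)).of_eq (fun _ => rfl) (by simp; ring)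

theorem hasDerivAt_div_parabola {t : ℝ} (h0 : t * (T - t) ≠ 0) (s : ℝ) :
    HasDerivAt (fun t => s / (t * (T - t))) (-(s * (T - 2 * t)) / (t * (T - t)) ^ 2) t := by
  have hq := hasDerivAt_parabola T t
  exact ((hasDerivAt_const t s).div hq h0).of_eq (fun _ => rfl) (by simp)

theorem hasDerivAt_deriv_div_parabola {t : ℝ} (h0 : t * (T - t) ≠ 0) (s : ℝ) :
    HasDerivAt (fun t => -(s * (T - 2 * t)) / (t * (T - t)) ^ 2)
      (s * (2 * (t * (T - t)) + 2 * (T - 2 * t) ^ 2) / (t * (T - t)) ^ 3) t := by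
  have hq := hasDerivAt_parabola T t
  have hn : HasDerivAt (fun t => -(s * (T - 2 * t))) (2 * s) t :=
    (((((hasDerivAt_id t).const_mul 2).const_sub T).const_mul s).neg).of_eq (fun _ => rfl) (by
      ring)
  refine (hn.div (hq.pow 2) (pow_ne_zero 2 h0)).of_eq (fun _ => rfl) ?_
  simp only [Pi.pow_apply]
  generalize t * (T - t) = q at *
  push_cast
  field_simp
  ring

theorem timeWeight_div_parabola (hT : 0 < T) (ha : 0 ≤ a) (hε : ε ∈ Ioo (0 : ℝ) 1)
    (hs : 1000 * ((T + T ^ 2) / ε + sqrt a * T ^ 2 / sqrt ε) ≤ s) :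
    TimeWeight T ε a (fun t => s / (t * (T - t)))
      (fun t => -(s * (T - 2 * t)) / (t * (T - t)) ^ 2)
      (fun t => s * (2 * (t * (T - t)) + 2 * (T - 2 * t) ^ 2) / (t * (T - t)) ^ 3) := by
  obtain ⟨hε0, hε1⟩ := hε
  have hsε : 0 < sqrt ε := sqrt_pos.2 hε0
  have hA : 0 ≤ sqrt a * T ^ 2 / sqrt ε := by positivity
  have hB : 0 ≤ (T + T ^ 2) / ε := by positivity
  have s1 : 1000 * (T + T ^ 2) ≤ ε * s := by
    have : 1000 * ((T + T ^ 2) / ε) ≤ s := by linarith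
    rw [mul_div_assoc', div_le_iff₀ hε0] at this
    linarith
  have s2 : 1000 * (sqrt a * T ^ 2) ≤ sqrt ε * s := by
    have : 1000 * (sqrt a * T ^ 2 / sqrt ε) ≤ s := by linarith
    rw [mul_div_assoc', div_le_iff₀ hsε] at this
    linarith
  have s3 : 1000000 * (a * T ^ 4) ≤ ε * s ^ 2 := by
    have := pow_le_pow_left₀ (by positivity) s2 2
    calc _ = (1000 * (sqrt a * T ^ 2)) ^ 2 := by
            rw [mul_pow, mul_pow, sq_sqrt ha]; ring
      _ ≤ _ := this
      _ = _ := by rw [mul_pow, sq_sqrt hε0.le]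
  have hs0 : 0 < s := by
    by_contra! h
    nlinarith
  have hq0 : ∀ t ∈ Ioo 0 T, 0 < t * (T - t) := fun t ht => mul_pos ht.1 (sub_pos.2 ht.2)
  have hqT : ∀ t, t * (T - t) ≤ T ^ 2 := fun t => by
    nlinarith [sq_nonneg (T - 2 * t), sq_nonneg T]
  have hqc : Continuous fun t : ℝ => t * (T - t) := by fun_prop
  have htends : ∀ {f : Filter ℝ} {c : ℝ}, f ≤ 𝓝 c → c * (T - c) = 0 → (∀ᶠ t in f, t ∈ Ioo 0 T) →
      Filter.Tendsto (fun t => s / (t * (T - t))) f Filter.atTop := by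
    intro f c hf hc hm
    have h0 : Filter.Tendsto (fun t => t * (T - t)) f (𝓝[>] 0) := by
      refine tendsto_nhdsWithin_iff.2 ⟨?_, hm.mono hq0⟩
      rw [← hc]
      exact (hqc.tendsto c).mono_left hf
    exact (h0.inv_tendsto_nhdsGT_zero).const_mul_atTop hs0
  refine ⟨hε0, hε1, ha, fun t ht => hasDerivAt_div_parabola (hq0 t ht).ne' s,
    fun t ht => hasDerivAt_deriv_div_parabola (hq0 t ht).ne' s, ?_, ?_, ?_, ?_, ?_,
    htends nhdsWithin_le_nhds (by simp) (Ioo_mem_nhdsGT hT),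
    htends nhdsWithin_le_nhds (by simp) (Ioo_mem_nhdsLT hT)⟩
  · have : ∀ t ∈ Ioo 0 T, (t * (T - t)) ^ 3 ≠ 0 := fun t ht => (pow_pos (hq0 t ht) 3).ne'
    fun_prop (disch := assumption)
  · intro t ht
    have hq := hq0 t ht
    have := hqT t
    rw [mul_div_assoc', le_div_iff₀ hq]
    nlinarith
  · intro t ht
    have hq := hq0 t ht
    have hab : |T - 2 * t| ≤ T := abs_le.2 ⟨by linarith [ht.2], by linarith [ht.1]⟩
    rw [abs_div, abs_neg, abs_mul, abs_of_pos hs0, abs_of_pos (pow_pos hq 2), div_pow,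
      mul_div_assoc', mul_div_assoc']
    refine div_le_div_of_nonneg_right ?_ (by positivity)
    have h1 := mul_le_mul_of_nonneg_left hab hs0.le
    have h2 := mul_le_mul_of_nonneg_left s1 hs0.le
    nlinarith [mul_nonneg hs0.le (sq_nonneg T)]
  · intro t ht
    have hq := hq0 t ht
    rw [abs_of_pos (by positivity), div_pow, mul_div_assoc', mul_div_assoc']
    refine div_le_div_of_nonneg_right ?_ (by positivity)
    have h1 : 2 * (t * (T - t)) + 2 * (T - 2 * t) ^ 2 ≤ 2 * T ^ 2 := by nlinarith
    have h2 : (1000 * T) ^ 2 ≤ (ε * s) ^ 2 :=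
      pow_le_pow_left₀ (by positivity) (by nlinarith) 2
    have h3 := mul_le_mul_of_nonneg_left h1 hs0.le
    have h4 := mul_le_mul_of_nonneg_left h2 hs0.le
    nlinarith [mul_nonneg hs0.le (sq_nonneg T)]
  · intro t ht
    have hq := hq0 t ht
    have h1 : (t * (T - t)) ^ 2 ≤ (T ^ 2) ^ 2 := by gcongr; exact hqT t
    rw [div_pow, mul_div_assoc', le_div_iff₀ (by positivity)]
    nlinarith [mul_le_mul_of_nonneg_left h1 ha, mul_nonneg ha (pow_nonneg hT.le 4)]

theorem traceTerm_div_parabola (φ : ℝ → ℝ → ℝ) (t x : ℝ) :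
    traceTerm (fun t => s / (t * (T - t))) φ t x
      = s ^ 3 * (carlW' T t x ^ 3 * exp (-2 * s * carlA' T t x) * φ t x ^ 2) := by
  have e : -(2 * (exp 3 - exp (1 - x)) * (s / (t * (T - t))))
      = -2 * s * ((exp 3 - exp (1 - x)) / (t * (T - t))) := by ring
  simp only [traceTerm, carlW', carlA', carlE, e]
  ring

theorem obsTerm_div_parabola (φ : ℝ → ℝ → ℝ) (t : ℝ) :
    s ^ 7 * (exp (-4 * s * carlA' T t (-1) + 2 * s * carlA' T t 0) * carlW' T t (-1) ^ 7
      * φ t (-1) ^ 2)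
      = exp (1 - (-1)) ^ 7 * obsTerm (fun t => s / (t * (T - t))) φ t := by
  have e : carlE (s / (t * (T - t))) (-1) ^ 2 / carlE (s / (t * (T - t))) 0
      = exp (-4 * s * carlA' T t (-1) + 2 * s * carlA' T t 0) := by
    unfold carlE carlA'
    rw [← exp_nat_mul, ← exp_sub]
    congr 1
    push_cast
    ring
  simp only [obsTerm, e, carlW']
  ring

end

/-- Carleman inequality with observation at `x = −1` (Remark 4). -/
theorem carleman_inequality_at_left_endpoint :
    ∃ C > (0:ℝ), ∃ s0 > (0:ℝ), ∀ T > (0:ℝ), ∀ a ≥ (0:ℝ), ∀ ε ∈ Set.Ioo (0:ℝ) 1,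
      ∀ s ≥ s0 * ((T + T ^ 2) / ε + Real.sqrt a * T ^ 2 / Real.sqrt ε),
      ∀ φ : ℝ → ℝ → ℝ, IsAdjSol1D T ε a φ →
        s ^ 3 * (∫ t in (0:ℝ)..T, ∫ x in (-1:ℝ)..0,
              carlW' T t x ^ 3 * Real.exp (-2 * s * carlA' T t x) * φ t x ^ 2)
          + s ^ 3 * (∫ t in (0:ℝ)..T,
              carlW' T t 0 ^ 3 * Real.exp (-2 * s * carlA' T t 0) * φ t 0 ^ 2
              + carlW' T t (-1) ^ 3 * Real.exp (-2 * s * carlA' T t (-1)) * φ t (-1) ^ 2)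
        ≤ C * s ^ 7 * ∫ t in (0:ℝ)..T,
              Real.exp (-4 * s * carlA' T t (-1) + 2 * s * carlA' T t 0)
                * carlW' T t (-1) ^ 7 * φ t (-1) ^ 2 := by
  refine ⟨600000000, by norm_num, 1000, by norm_num, fun T hT a ha ε hε s hs φ hφ => ?_⟩
  have hw := timeWeight_div_parabola hT ha hε hs
  have key := AdjSys.carleman hT hw hφ.adjSys
  set l : ℝ → ℝ := fun t => s / (t * (T - t)) with hl
  have e1 : (∫ t in (0 : ℝ)..T, interiorTerm l φ t) = s ^ 3 * (∫ t in (0:ℝ)..T,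
      ∫ x in (-1:ℝ)..0, carlW' T t x ^ 3 * Real.exp (-2 * s * carlA' T t x) * φ t x ^ 2) := by
    simp_rw [← intervalIntegral.integral_const_mul, ← traceTerm_div_parabola]
    rfl
  have e2 : (∫ t in (0 : ℝ)..T, (traceTerm l φ t 0 + traceTerm l φ t (-1)))
      = s ^ 3 * (∫ t in (0:ℝ)..T,
        carlW' T t 0 ^ 3 * Real.exp (-2 * s * carlA' T t 0) * φ t 0 ^ 2
        + carlW' T t (-1) ^ 3 * Real.exp (-2 * s * carlA' T t (-1)) * φ t (-1) ^ 2) := by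
    simp_rw [← intervalIntegral.integral_const_mul, mul_add, ← traceTerm_div_parabola]
    rfl
  have e3 : s ^ 7 * (∫ t in (0:ℝ)..T, Real.exp (-4 * s * carlA' T t (-1) + 2 * s * carlA' T t 0)
      * carlW' T t (-1) ^ 7 * φ t (-1) ^ 2)
      = exp (1 - (-1)) ^ 7 * ∫ t in (0 : ℝ)..T, obsTerm l φ t := by
    simp_rw [← intervalIntegral.integral_const_mul, obsTerm_div_parabola]
    rfl
  have hs0 : 0 < s := (div_pos_iff_of_pos_right
    (mul_pos (half_pos hT) (sub_pos.2 (half_lt_self hT)))).1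
    (hw.pos ⟨half_pos hT, half_lt_self hT⟩)
  have hO : 0 ≤ ∫ t in (0 : ℝ)..T, obsTerm l φ t := by
    refine intervalIntegral.integral_nonneg_of_ae_restrict hT.le
      ((ae_restrict_iff' measurableSet_Icc).2 (Filter.Eventually.of_forall fun t ht => ?_))
    have e0 := carlE_pos (l t) (-1)
    have e1 := carlE_pos (l t) 0
    have hl0 : 0 ≤ l t := div_nonneg hs0.le (mul_nonneg ht.1 (sub_nonneg.2 ht.2))
    simp only [obsTerm, Pi.zero_apply]
    positivity
  have hk : 1 ≤ exp (1 - (-1)) ^ 7 := one_le_pow₀ (one_le_exp (by norm_num))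
  rw [← e1, ← e2, mul_assoc, e3]
  nlinarith
end
end

section
/- Dissipation estimate by exponential weight: For every ε > 0, every a ≥ 0, every T > 0, every classical solution φ of (S'^a), and all 0 ≤ t1 < t2 ≤ T with t2 − t1 > 1, one has ‖φ(t1,·)‖_{X¹} ≤ exp( −(t2 − t1 − 1)² / (4 ε (t2 − t1)) ) · ‖φ(t2,·)‖_{X¹}. -/
open Real MeasureTheory intervalIntegral Set

noncomputable section

/-- Leibniz rule for an interval integral with jointly continuous partial derivative. -/
theorem hasDerivAt_intervalIntegral_of_continuous {G G' : ℝ → ℝ → ℝ} {b c : ℝ}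
    (hG : Continuous fun p : ℝ × ℝ => G p.1 p.2)
    (hG' : Continuous fun p : ℝ × ℝ => G' p.1 p.2)
    (hd : ∀ t x, HasDerivAt (fun r => G r x) (G' t x) t) (t : ℝ) :
    HasDerivAt (fun r => ∫ x in b..c, G r x) (∫ x in b..c, G' t x) t := by
  have hsec : ∀ r, Continuous (G r) := fun r => hG.comp (by fun_prop : Continuous fun x => (r, x))
  have hsec' : ∀ r, Continuous (G' r) :=
    fun r => hG'.comp (by fun_prop : Continuous fun x => (r, x))
  obtain ⟨C, hC⟩ := ((isCompact_Icc (a := t - 1) (b := t + 1)).prod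
    (isCompact_uIcc (a := b) (b := c))).exists_bound_of_continuousOn hG'.continuousOn
  refine (intervalIntegral.hasDerivAt_integral_of_dominated_loc_of_deriv_le (bound := fun _ => C)
    (Icc_mem_nhds (by linarith : t - 1 < t) (by linarith : t < t + 1))
    (Filter.Eventually.of_forall fun r => (hsec r).aestronglyMeasurable)
    ((hsec t).intervalIntegrable _ _) (hsec' t).aestronglyMeasurable ?_ (by simp) ?_).2
  · exact Filter.Eventually.of_forall fun x hx r hr => hC (r, x) ⟨hr, uIoc_subset_uIcc hx⟩
  · exact Filter.Eventually.of_forall fun x _ r _ => hd r x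

/-- The partial derivative in the first variable of a smooth function is smooth. -/
theorem contDiff_deriv_fst {f : ℝ → ℝ → ℝ}
    (hf : ContDiff ℝ (⊤ : ℕ∞) fun p : ℝ × ℝ => f p.1 p.2) :
    ContDiff ℝ (⊤ : ℕ∞) fun p : ℝ × ℝ => deriv (fun r => f r p.2) p.1 := by
  have key : (fun p : ℝ × ℝ => deriv (fun r => f r p.2) p.1) =
      fun p => fderiv ℝ (fun p : ℝ × ℝ => f p.1 p.2) p (1, 0) := by
    funext p
    have h := (hf.differentiable (by simp) p).hasFDerivAt
    exact (h.comp_hasDerivAt (f := fun r : ℝ => (r, p.2)) p.1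
      ((hasDerivAt_id p.1).prodMk (hasDerivAt_const p.1 p.2))).deriv
  rw [key]
  exact (hf.fderiv_right (m := (⊤ : ℕ∞)) (by simp)).clm_apply contDiff_const

/-- The partial derivative in the second variable of a smooth function is smooth. -/
theorem contDiff_deriv_snd {f : ℝ → ℝ → ℝ}
    (hf : ContDiff ℝ (⊤ : ℕ∞) fun p : ℝ × ℝ => f p.1 p.2) :
    ContDiff ℝ (⊤ : ℕ∞) fun p : ℝ × ℝ => deriv (f p.1) p.2 :=
  (contDiff_deriv_fst (f := fun x t => f t x) (hf.comp (contDiff_snd.prodMk contDiff_fst))).comp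
    (contDiff_snd.prodMk contDiff_fst)

theorem hasDerivAt_fst {f : ℝ → ℝ → ℝ}
    (hf : ContDiff ℝ (⊤ : ℕ∞) fun p : ℝ × ℝ => f p.1 p.2) (t x : ℝ) :
    HasDerivAt (fun r => f r x) (deriv (fun r => f r x) t) t :=
  (((hf.comp (contDiff_id.prodMk contDiff_const)).differentiable (by simp) :
    Differentiable ℝ fun r => f r x) t).hasDerivAt

theorem hasDerivAt_snd {f : ℝ → ℝ → ℝ}
    (hf : ContDiff ℝ (⊤ : ℕ∞) fun p : ℝ × ℝ => f p.1 p.2) (t x : ℝ) :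
    HasDerivAt (f t) (deriv (f t) x) x :=
  hasDerivAt_fst (f := fun x t => f t x) (hf.comp (contDiff_snd.prodMk contDiff_fst)) x t

/-- The squared `X¹`-norm with exponential weight `exp (s x)`. -/
def weightedNormSq (ε s : ℝ) (ψ : ℝ → ℝ) : ℝ :=
  (∫ x in (-1:ℝ)..0, exp (s * x) * ψ x ^ 2) + ε * (ψ 0 ^ 2 + exp (-s) * ψ (-1) ^ 2)

theorem weightedNormSq_le {ε s : ℝ} (hε : 0 ≤ ε) (hs : 0 ≤ s) {ψ : ℝ → ℝ} (hψ : Continuous ψ) :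
    weightedNormSq ε s ψ ≤ X1normSq ε ψ := by
  unfold weightedNormSq X1normSq
  have hI : (∫ x in (-1:ℝ)..0, exp (s * x) * ψ x ^ 2) ≤ ∫ x in (-1:ℝ)..0, ψ x ^ 2 := by
    refine integral_mono_on (by norm_num) (Continuous.intervalIntegrable (by fun_prop) _ _)
      (Continuous.intervalIntegrable (by fun_prop) _ _) fun x hx => ?_
    exact mul_le_of_le_one_left (sq_nonneg _)
      (exp_le_one_iff.2 (mul_nonpos_of_nonneg_of_nonpos hs hx.2))
  have h1 : exp (-s) * ψ (-1) ^ 2 ≤ ψ (-1) ^ 2 :=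
    mul_le_of_le_one_left (sq_nonneg _) (exp_le_one_iff.2 (by linarith))
  gcongr

theorem exp_neg_mul_le_weightedNormSq {ε s : ℝ} (hε : 0 ≤ ε) (hs : 0 ≤ s) {ψ : ℝ → ℝ}
    (hψ : Continuous ψ) : exp (-s) * X1normSq ε ψ ≤ weightedNormSq ε s ψ := by
  unfold weightedNormSq X1normSq
  have hI : exp (-s) * (∫ x in (-1:ℝ)..0, ψ x ^ 2) ≤
      ∫ x in (-1:ℝ)..0, exp (s * x) * ψ x ^ 2 := by
    rw [← intervalIntegral.integral_const_mul]
    refine integral_mono_on (by norm_num) (Continuous.intervalIntegrable (by fun_prop) _ _)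
      (Continuous.intervalIntegrable (by fun_prop) _ _) fun x hx => ?_
    gcongr
    nlinarith [hx.1]
  have h1 : exp (-s) * ψ 0 ^ 2 ≤ ψ 0 ^ 2 :=
    mul_le_of_le_one_left (sq_nonneg _) (exp_le_one_iff.2 (by linarith))
  nlinarith [mul_le_mul_of_nonneg_left h1 hε]

theorem hasDerivAt_weightedNormSq {φ : ℝ → ℝ → ℝ}
    (hφ : ContDiff ℝ (⊤ : ℕ∞) fun p : ℝ × ℝ => φ p.1 p.2) (ε s t : ℝ) :
    HasDerivAt (fun r => weightedNormSq ε s (φ r))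
      ((∫ x in (-1:ℝ)..0, exp (s * x) * (2 * φ t x * deriv (fun r => φ r x) t)) +
        ε * (2 * φ t 0 * deriv (fun r => φ r 0) t +
          exp (-s) * (2 * φ t (-1) * deriv (fun r => φ r (-1)) t))) t := by
  have hc := hφ.continuous
  have hct := (contDiff_deriv_fst hφ).continuous
  have hd : ∀ t x, HasDerivAt (fun r => φ r x ^ 2) (2 * φ t x * deriv (fun r => φ r x) t) t :=
    fun t x => by simpa using (hasDerivAt_fst hφ t x).fun_pow 2
  refine HasDerivAt.add ?_ (((hd t 0).add ((hd t (-1)).const_mul _)).const_mul ε)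
  exact hasDerivAt_intervalIntegral_of_continuous
    (G := fun r x => exp (s * x) * φ r x ^ 2)
    (G' := fun r x => exp (s * x) * (2 * φ r x * deriv (fun r => φ r x) r))
    (by fun_prop) (by fun_prop) (fun t x => (hd t x).const_mul _) t

/-- Differential inequality for the weighted norm along solutions. -/
theorem IsAdjSol1D.mul_weightedNormSq_le {T ε a : ℝ} {φ : ℝ → ℝ → ℝ} (h : IsAdjSol1D T ε a φ)
    (hε : 0 < ε) (ha : 0 ≤ a) (s : ℝ) {t : ℝ} (ht : t ∈ Ioo 0 T) :
    (s - ε * s ^ 2 / 2) * weightedNormSq ε s (φ t) ≤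
      deriv (fun r => weightedNormSq ε s (φ r)) t := by
  obtain ⟨hφ, hpde, hb0, hb1⟩ := h
  rw [(hasDerivAt_weightedNormSq hφ ε s t).deriv]
  have hline : Continuous fun x : ℝ => (t, x) := by fun_prop
  have hc : Continuous (φ t) := hφ.continuous.comp hline
  have hct : Continuous fun x => deriv (fun r => φ r x) t :=
    (contDiff_deriv_fst hφ).continuous.comp hline
  have hcx : Continuous (deriv (φ t)) := (contDiff_deriv_snd hφ).continuous.comp hline
  have hcxx : Continuous (deriv (deriv (φ t))) :=
    (contDiff_deriv_snd (f := fun t => deriv (φ t)) (contDiff_deriv_snd hφ)).continuous.comp hline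
  have hw : ∀ x, HasDerivAt (fun x => exp (s * x)) (exp (s * x) * s) x := fun x => by
    simpa using ((hasDerivAt_id x).const_mul s).exp
  let F' : ℝ → ℝ := fun x => exp (s * x) * (s * φ t x ^ 2 + 2 * φ t x * deriv (φ t) x +
    2 * ε * (s * φ t x * deriv (φ t) x + deriv (φ t) x ^ 2 + φ t x * deriv (deriv (φ t)) x))
  have hF : ∀ x, HasDerivAt
      (fun x => exp (s * x) * (φ t x ^ 2 + 2 * ε * (φ t x * deriv (φ t) x))) (F' x) x := by
    intro x
    have h1 := hasDerivAt_snd hφ t x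
    have h2 : HasDerivAt (deriv (φ t)) (deriv (deriv (φ t)) x) x :=
      hasDerivAt_snd (f := fun t => deriv (φ t)) (contDiff_deriv_snd hφ) t x
    refine ((hw x).mul ((h1.fun_pow 2).add ((h1.mul h2).const_mul (2 * ε)))).congr_deriv ?_
    simp [F']
    ring
  have hF'c : Continuous F' := by fun_prop
  have hftc := integral_eq_sub_of_hasDerivAt (a := -1) (b := 0) (fun x _ => hF x)
    (hF'c.intervalIntegrable _ _)
  have hint : (∫ x in (-1:ℝ)..0, ((s - ε * s ^ 2 / 2) * (exp (s * x) * φ t x ^ 2) - F' x)) ≤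
      ∫ x in (-1:ℝ)..0, exp (s * x) * (2 * φ t x * deriv (fun r => φ r x) t) := by
    refine integral_mono_on_of_le_Ioo (by norm_num)
      (Continuous.intervalIntegrable (by fun_prop) _ _)
      (Continuous.intervalIntegrable (by fun_prop) _ _) fun x hx => ?_
    have hp := hpde t ht x hx
    have e : deriv (fun r => φ r x) t =
        a * φ t x - deriv (φ t) x - ε * deriv (deriv (φ t)) x := by linarith
    rw [e, ← sub_nonneg]
    have : exp (s * x) * (2 * φ t x * (a * φ t x - deriv (φ t) x - ε * deriv (deriv (φ t)) x)) -
        ((s - ε * s ^ 2 / 2) * (exp (s * x) * φ t x ^ 2) - F' x) =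
        exp (s * x) * (2 * a * φ t x ^ 2 + 2 * ε * (deriv (φ t) x + s / 2 * φ t x) ^ 2) := by
      simp only [F']
      ring
    rw [this]
    positivity
  rw [intervalIntegral.integral_sub (Continuous.intervalIntegrable (by fun_prop) _ _)
    (hF'c.intervalIntegrable _ _), intervalIntegral.integral_const_mul, hftc] at hint
  have e0 : ε * deriv (fun r => φ r 0) t = ε * deriv (φ t) 0 + φ t 0 := by
    linarith [hb0 t ht]
  have e1 : deriv (fun r => φ r (-1)) t = -deriv (φ t) (-1) := by linarith [hb1 t ht]
  have hs0 : exp (s * 0) = 1 := by simp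
  have hs1 : exp (s * -1) = exp (-s) := by simp
  rw [hs0, hs1] at hint
  unfold weightedNormSq
  have hB : ε * (2 * φ t 0 * deriv (fun r => φ r 0) t +
          exp (-s) * (2 * φ t (-1) * deriv (fun r => φ r (-1)) t)) =
      2 * φ t 0 * (ε * deriv (φ t) 0 + φ t 0) -
        2 * ε * exp (-s) * φ t (-1) * deriv (φ t) (-1) := by
    rw [← e0, e1]
    ring
  rw [hB]
  have hl : 0 ≤ 1 - ε * (s - ε * s ^ 2 / 2) := by nlinarith [sq_nonneg (ε * s - 1)]
  have hN : 0 ≤ φ t 0 ^ 2 + exp (-s) * φ t (-1) ^ 2 := by positivity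
  nlinarith [mul_nonneg hl hN]

theorem IsAdjSol1D.weightedNormSq_le_exp_mul {T ε a : ℝ} {φ : ℝ → ℝ → ℝ}
    (h : IsAdjSol1D T ε a φ) (hε : 0 < ε) (ha : 0 ≤ a) (s : ℝ) {t₁ t₂ : ℝ}
    (h₁ : 0 ≤ t₁) (h₁₂ : t₁ ≤ t₂) (h₂ : t₂ ≤ T) :
    weightedNormSq ε s (φ t₁) ≤
      exp (-((s - ε * s ^ 2 / 2) * (t₂ - t₁))) * weightedNormSq ε s (φ t₂) := by
  set l := s - ε * s ^ 2 / 2 with hl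
  have hE : ∀ t, HasDerivAt (fun r => weightedNormSq ε s (φ r))
      (deriv (fun r => weightedNormSq ε s (φ r)) t) t :=
    fun t => (hasDerivAt_weightedNormSq h.1 ε s t).differentiableAt.hasDerivAt
  have hg : ∀ t, HasDerivAt (fun r => exp (-l * r) * weightedNormSq ε s (φ r))
      (exp (-l * t) * (deriv (fun r => weightedNormSq ε s (φ r)) t -
        l * weightedNormSq ε s (φ t))) t := by
    intro t
    refine ((((hasDerivAt_id t).const_mul (-l)).exp).mul (hE t)).congr_deriv ?_
    simp
    ring
  have hmono : MonotoneOn (fun r => exp (-l * r) * weightedNormSq ε s (φ r)) (Icc t₁ t₂) := by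
    refine monotoneOn_of_deriv_nonneg (convex_Icc _ _)
      (fun t _ => (hg t).continuousAt.continuousWithinAt)
      (fun t _ => (hg t).differentiableAt.differentiableWithinAt) fun t ht => ?_
    rw [interior_Icc] at ht
    rw [(hg t).deriv]
    exact mul_nonneg (exp_pos _).le (sub_nonneg.2
      (h.mul_weightedNormSq_le hε ha s ⟨h₁.trans_lt ht.1, ht.2.trans_le h₂⟩))
  have hm := hmono (left_mem_Icc.2 h₁₂) (right_mem_Icc.2 h₁₂) h₁₂
  have hm' := mul_le_mul_of_nonneg_left hm (exp_pos (l * t₁)).le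
  simp only [← mul_assoc, ← exp_add] at hm'
  have e₁ : l * t₁ + -l * t₁ = 0 := by ring
  have e₂ : l * t₁ + -l * t₂ = -(l * (t₂ - t₁)) := by ring
  rwa [e₁, e₂, exp_zero, one_mul] at hm'

/-- Dissipation estimate by exponential weight (case `a ≤ ε⁻¹` in the paper,
stated for every `a ≥ 0`). -/
theorem dissipation_exponential_weight :
    ∀ ε > (0:ℝ), ∀ a ≥ (0:ℝ), ∀ T > (0:ℝ),
      ∀ φ : ℝ → ℝ → ℝ, IsAdjSol1D T ε a φ →
      ∀ t1 t2 : ℝ, 0 ≤ t1 → t1 < t2 → t2 ≤ T → 1 < t2 - t1 →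
        Real.sqrt (X1normSq ε (φ t1)) ≤
          Real.exp (-((t2 - t1 - 1) ^ 2 / (4 * ε * (t2 - t1)))) *
            Real.sqrt (X1normSq ε (φ t2)) := by
  intro ε hε a ha T _ φ h t1 t2 h1 h12 h2 hτ
  set τ := t2 - t1 with hτd
  have hτ0 : 0 < τ := by linarith
  set s := (τ - 1) / (ε * τ) with hs_def
  have hs : 0 ≤ s := div_nonneg (by linarith) (by positivity)
  have hc : ∀ t, Continuous (φ t) := fun t =>
    h.1.continuous.comp (by fun_prop : Continuous fun x : ℝ => (t, x))
  have hX := (exp_neg_mul_le_weightedNormSq hε.le hs (hc t1)).trans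
    ((h.weightedNormSq_le_exp_mul hε ha s h1 h12.le h2).trans
      (mul_le_mul_of_nonneg_left (weightedNormSq_le hε.le hs (hc t2)) (exp_pos _).le))
  have hX' := mul_le_mul_of_nonneg_left hX (exp_pos s).le
  simp only [← mul_assoc, ← exp_add, add_neg_cancel, exp_zero, one_mul] at hX'
  have hexp : s + -((s - ε * s ^ 2 / 2) * (t2 - t1)) =
      -((τ - 1) ^ 2 / (4 * ε * τ)) + -((τ - 1) ^ 2 / (4 * ε * τ)) := by
    rw [← hτd, hs_def]
    field_simp
    ring
  rw [hexp, exp_add, ← pow_two] at hX'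
  calc _ ≤ _ := Real.sqrt_le_sqrt hX'
    _ = _ := by rw [Real.sqrt_mul (sq_nonneg _), Real.sqrt_sq (exp_pos _).le]
end
end

section
/- Weighted energy differential inequality: Let ε > 0, a ≥ 0, λ ∈ (0,1), and set θ(x) = exp(λ x / ε) for x ∈ [−1,0]. Then for every classical solution φ of (S'^a) and every t ∈ (0,T), d/dt [ ∫_{−1}^0 θ(x) |φ(t,x)|² dx + ε( θ(0) |φ(t,0)|² + θ(−1) |φ(t,−1)|² ) ] ≥ (λ(1−λ)/ε) [ ∫_{−1}^0 θ(x) |φ(t,x)|² dx + ε( θ(0) |φ(t,0)|² + θ(−1) |φ(t,−1)|² ) ]. -/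
open Real MeasureTheory intervalIntegral Set

noncomputable section

/-- Differentiation under the integral sign for a jointly continuous partial derivative. -/
theorem hasDerivAt_intervalIntegral_of_continuous_s8 {F F' : ℝ → ℝ → ℝ}
    (hF : ∀ s, Continuous (F s)) (hF' : Continuous (Function.uncurry F'))
    (h : ∀ s x, HasDerivAt (fun r => F r x) (F' s x) s) (a b t : ℝ) :
    HasDerivAt (fun s => ∫ x in a..b, F s x) (∫ x in a..b, F' t x) t := by
  obtain ⟨C, hC⟩ := ((isCompact_closedBall t 1).prod (isCompact_uIcc (a := a) (b := b))
    ).exists_bound_of_continuousOn hF'.continuousOn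
  refine (intervalIntegral.hasDerivAt_integral_of_dominated_loc_of_deriv_le
    (bound := fun _ => C) (Metric.closedBall_mem_nhds t one_pos)
    (Filter.Eventually.of_forall fun s => (hF s).aestronglyMeasurable)
    ((hF t).intervalIntegrable _ _)
    (hF'.comp (Continuous.prodMk_right t)).aestronglyMeasurable
    (Filter.Eventually.of_forall fun x hx s hs => hC (s, x) ⟨hs, uIoc_subset_uIcc hx⟩)
    intervalIntegrable_const
    (Filter.Eventually.of_forall fun x _ s _ => h s x)).2

/-- The time derivative of a smooth function of `(t, x)` exists and is jointly continuous. -/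
theorem hasDerivAt_fst_and_continuous_of_contDiff {φ : ℝ → ℝ → ℝ}
    (hφ : ContDiff ℝ (⊤ : ℕ∞) (fun p : ℝ × ℝ => φ p.1 p.2)) :
    (∀ s x, HasDerivAt (fun r => φ r x) (deriv (fun r => φ r x) s) s) ∧
      Continuous (fun p : ℝ × ℝ => deriv (fun r => φ r p.2) p.1) := by
  have key : ∀ s x, HasDerivAt (fun r => φ r x)
      (fderiv ℝ (fun p : ℝ × ℝ => φ p.1 p.2) (s, x) (1, 0)) s := fun s x =>
    ((hφ.differentiable (by simp)) (s, x)).hasFDerivAt.comp_hasDerivAt (f := fun r => (r, x)) s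
      ((hasDerivAt_id' s).prodMk (hasDerivAt_const s x))
  refine ⟨fun s x => (key s x).differentiableAt.hasDerivAt, ?_⟩
  have e : (fun p : ℝ × ℝ => deriv (fun r => φ r p.2) p.1) =
      fun p => fderiv ℝ (fun p : ℝ × ℝ => φ p.1 p.2) p (1, 0) :=
    funext fun p => (key p.1 p.2).deriv
  rw [e]
  exact (hφ.continuous_fderiv (by simp)).clm_apply continuous_const

/-- Derivative of the flux `-(1 - λ) θ u² - 2 ε θ u u'` with `θ = exp (λ x / ε)`. -/
theorem hasDerivAt_weighted_flux {ε lam x : ℝ} (hε : ε ≠ 0) {u v : ℝ → ℝ} {w : ℝ}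
    (hu : HasDerivAt u (v x) x) (hv : HasDerivAt v w x) :
    HasDerivAt
      (fun y => Real.exp (lam * y / ε) * (-(1 - lam) * u y ^ 2 - 2 * ε * (u y * v y)))
      (Real.exp (lam * x / ε) *
        (-(lam * (1 - lam) / ε) * u x ^ 2 - 2 * u x * (v x + ε * w) - 2 * ε * v x ^ 2)) x := by
  have hθ : HasDerivAt (fun y => Real.exp (lam * y / ε))
      (Real.exp (lam * x / ε) * (lam * 1 / ε)) x :=
    (((hasDerivAt_id x).const_mul lam).div_const ε).exp
  refine (hθ.mul (((hu.pow 2).const_mul (-(1 - lam))).sub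
    ((hu.mul hv).const_mul (2 * ε)))).congr_deriv ?_
  simp only [Pi.mul_apply, Pi.pow_apply, Pi.sub_apply]
  field_simp
  ring

/-- Weighted energy differential inequality, with `θ(x) = exp(λx/ε)`:
`d/dt ‖√θ φ(t)‖²_{X¹} ≥ (λ(1−λ)/ε) ‖√θ φ(t)‖²_{X¹}` for `t ∈ (0,T)`. -/
theorem weighted_energy_differential_inequality :
    ∀ T > (0:ℝ), ∀ ε > (0:ℝ), ∀ a ≥ (0:ℝ), ∀ lam ∈ Set.Ioo (0:ℝ) 1,
      ∀ φ : ℝ → ℝ → ℝ, IsAdjSol1D T ε a φ →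
      ∀ t ∈ Set.Ioo (0:ℝ) T,
        (lam * (1 - lam) / ε) *
            ((∫ x in (-1:ℝ)..0, Real.exp (lam * x / ε) * φ t x ^ 2)
              + ε * (Real.exp (lam * 0 / ε) * φ t 0 ^ 2
                  + Real.exp (lam * (-1) / ε) * φ t (-1) ^ 2))
          ≤ deriv (fun s =>
              (∫ x in (-1:ℝ)..0, Real.exp (lam * x / ε) * φ s x ^ 2)
                + ε * (Real.exp (lam * 0 / ε) * φ s 0 ^ 2
                    + Real.exp (lam * (-1) / ε) * φ s (-1) ^ 2)) t := by
  intro T _ ε hε a ha lam ⟨hl0, hl1⟩ φ ⟨hφ, hpde, hbc0, hbc1⟩ t ht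
  obtain ⟨hdt, hct⟩ := hasDerivAt_fst_and_continuous_of_contDiff hφ
  have hslice (s : ℝ) : ContDiff ℝ (⊤ : ℕ∞) (φ s) :=
    hφ.comp (contDiff_const.prodMk contDiff_id)
  have hθc : Continuous fun x : ℝ => Real.exp (lam * x / ε) := by fun_prop
  have hdx (s x : ℝ) : HasDerivAt (φ s) (deriv (φ s) x) x :=
    ((hslice s).differentiable (by simp) x).hasDerivAt
  have hslice' : ContDiff ℝ (⊤ : ℕ∞) (deriv (φ t)) :=
    (contDiff_infty_iff_deriv.1 (hslice t)).2
  have hdxx (x : ℝ) : HasDerivAt (deriv (φ t)) (deriv (deriv (φ t)) x) x :=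
    (hslice'.differentiable (by simp) x).hasDerivAt
  have hcu : Continuous (φ t) := (hslice t).continuous
  have hcv : Continuous (deriv (φ t)) := hslice'.continuous
  have hcw : Continuous (deriv (deriv (φ t))) := hslice'.continuous_deriv (by simp)
  have hctt : Continuous fun x => deriv (fun r => φ r x) t :=
    hct.comp (Continuous.prodMk_right t)
  have hsq (s x : ℝ) : HasDerivAt (fun r => Real.exp (lam * x / ε) * φ r x ^ 2)
      (Real.exp (lam * x / ε) * (2 * φ s x * deriv (fun r => φ r x) s)) s := by
    simpa using ((hdt s x).pow 2).const_mul (Real.exp (lam * x / ε))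
  have hint : HasDerivAt (fun s => ∫ x in (-1:ℝ)..0, Real.exp (lam * x / ε) * φ s x ^ 2)
      (∫ x in (-1:ℝ)..0,
        Real.exp (lam * x / ε) * (2 * φ t x * deriv (fun r => φ r x) t)) t := by
    refine hasDerivAt_intervalIntegral_of_continuous_s8
      (fun s => hθc.mul ((hslice s).continuous.pow 2)) ?_ hsq _ _ t
    exact (hθc.comp continuous_snd).mul ((continuous_const.mul hφ.continuous).mul hct)
  have hflux := integral_eq_sub_of_hasDerivAt (a := -1) (b := 0)
    (fun x _ => hasDerivAt_weighted_flux (lam := lam) hε.ne' (hdx t x) (hdxx x))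
    (Continuous.intervalIntegrable (by fun_prop) _ _)
  have hmono : (∫ x in (-1:ℝ)..0, (lam * (1 - lam) / ε * (Real.exp (lam * x / ε) * φ t x ^ 2) +
        Real.exp (lam * x / ε) * (-(lam * (1 - lam) / ε) * φ t x ^ 2
          - 2 * φ t x * (deriv (φ t) x + ε * deriv (deriv (φ t)) x)
          - 2 * ε * deriv (φ t) x ^ 2))) ≤
      ∫ x in (-1:ℝ)..0,
        Real.exp (lam * x / ε) * (2 * φ t x * deriv (fun r => φ r x) t) := by
    refine integral_mono_on_of_le_Ioo (by norm_num)
      (Continuous.intervalIntegrable (by fun_prop) _ _)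
      (Continuous.intervalIntegrable (by fun_prop) _ _) fun x hx => ?_
    have hp : deriv (fun s => φ s x) t =
        a * φ t x - deriv (φ t) x - ε * deriv (deriv (φ t)) x := by
      linear_combination hpde t ht x hx
    have h1 : 0 ≤ Real.exp (lam * x / ε) *
        (2 * ε * deriv (φ t) x ^ 2 + 2 * a * φ t x ^ 2) := by positivity
    rw [hp]
    linear_combination h1
  rw [integral_add (Continuous.intervalIntegrable (by fun_prop) _ _)
    (Continuous.intervalIntegrable (by fun_prop) _ _), hflux,
    intervalIntegral.integral_const_mul] at hmono
  refine le_of_le_of_eq ?_ (hint.add (((hsq t 0).add (hsq t (-1))).const_mul ε)).deriv.symm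
  have h0 : ε * deriv (fun s => φ s 0) t = ε * deriv (φ t) 0 + φ t 0 := by
    linear_combination hbc0 t ht
  have h1 : deriv (fun s => φ s (-1)) t = -deriv (φ t) (-1) := by
    linear_combination hbc1 t ht
  have hc : lam * (1 - lam) / ε * ε = lam * (1 - lam) := by field_simp
  have p0 : 0 ≤ Real.exp (lam * 0 / ε) * φ t 0 ^ 2 * (1 + lam ^ 2) := by positivity
  have p1 : 0 ≤ Real.exp (lam * (-1) / ε) * φ t (-1) ^ 2 * (1 - lam) ^ 2 := by positivity
  rw [h1]
  linear_combination hmono + p0 + p1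
    - 2 * Real.exp (lam * 0 / ε) * φ t 0 * h0
    + (Real.exp (lam * 0 / ε) * φ t 0 ^ 2 + Real.exp (lam * (-1) / ε) * φ t (-1) ^ 2) * hc
end
end
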